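/- arXiv:2211.07694 — 2 statements merged into one kernel-verified Lean document; each statement's English description precedes it below -/
import Mathlib

section
/- Let X_1, ..., X_d be Polish spaces, μ_i ∈ P(X_i), let α : [0,1] → [0,∞) be nondecreasing and bounded with μ_0 = α_# Leb_{[0,1]}, let b : X_1 × ... × X_d → ℝ be continuous and bounded, and set s(x_0, x_1, ..., x_d) = x_0 · b(x_1, ..., x_d). Then π ∈ Γ(μ_0, μ_1, ..., μ_d) maximizes ∫ s dπ over Γ(μ_0, μ_1, ..., μ_d) if and only if its (1,...,d)-marginal γ maximizes γ ↦ R_α(b_# γ) over Γ(μ_1, ..., μ_d) and the measure τ_π = ((x_0, ..., x_d) ↦ (x_0, b(x_1, ..., x_d)))_# π has monotone increasing support. -/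
open MeasureTheory Set

/-- Quantile (generalized inverse c.d.f.) of a probability measure on ℝ. -/
noncomputable def quantile (μ : Measure ℝ) (m : ℝ) : ℝ :=
  sInf {x : ℝ | ENNReal.ofReal m ≤ μ (Iic x)}

/-- Lebesgue measure restricted to `[0,1]`. -/
noncomputable def lebI : Measure ℝ := volume.restrict (Icc (0:ℝ) 1)

/-- The spectral risk measure `R_α(μ) = ∫_0^1 F_μ⁻¹(m) α(m) dm`. -/
noncomputable def specRisk (α : ℝ → ℝ) (μ : Measure ℝ) : ℝ :=
  ∫ m in Icc (0:ℝ) 1, quantile μ m * α m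

/-- Topological support of a measure. -/
def msupport {X : Type*} [TopologicalSpace X] [MeasurableSpace X] (π : Measure X) :
    Set X :=
  {x | ∀ U ∈ nhds x, π U ≠ 0}

/-- A subset of ℝ² is monotone increasing if `x < x'` implies `y ≤ y'` for any two
of its points `(x,y)`, `(x',y')`. -/
def MonotoneIncrSet (S : Set (ℝ × ℝ)) : Prop :=
  ∀ p ∈ S, ∀ q ∈ S, p.1 < q.1 → p.2 ≤ q.2

/-- Quadrant formulation of monotonicity of a planar measure. -/
def QuadMono (τ : Measure (ℝ × ℝ)) : Prop :=
  ∀ s t : ℝ, τ {p | s < p.1 ∧ p.2 ≤ t} = 0 ∨ τ {p | p.1 ≤ s ∧ t < p.2} = 0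

lemma quadMono_of_msupport (τ : Measure (ℝ × ℝ)) (h : MonotoneIncrSet (msupport τ)) :
    QuadMono τ := by
  intro s t
  by_contra! hc
  obtain ⟨h1, h2⟩ := hc
  have hsup : ∀ x, x ∈ τ.support → x ∈ msupport τ := by
    intro x hx U hU
    exact ((Measure.mem_support_iff_forall x).1 hx U hU).ne'
  obtain ⟨q, hq, hq'⟩ := Measure.nonempty_inter_support_of_pos (pos_iff_ne_zero.2 h1)
  obtain ⟨p, hp, hp'⟩ := Measure.nonempty_inter_support_of_pos (pos_iff_ne_zero.2 h2)
  have := h p (hsup p hp') q (hsup q hq') (lt_of_le_of_lt hp.1 hq.1)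
  exact absurd (lt_of_lt_of_le hp.2 (this.trans hq.2)) (lt_irrefl _)

lemma quad_le {τ τ' : Measure (ℝ × ℝ)} (h1 : τ.map Prod.fst = τ'.map Prod.fst)
    (h2 : τ.map Prod.snd = τ'.map Prod.snd) (hm : QuadMono τ) (s t : ℝ) :
    τ' {p | s < p.1 ∧ t < p.2} ≤ τ {p | s < p.1 ∧ t < p.2} ∧
    (τ' {p | s < p.1 ∧ t < p.2} = τ {p | s < p.1 ∧ t < p.2} → τ' {p | s < p.1 ∧ t < p.2} ≠ ⊤ →
      τ' {p | s < p.1 ∧ p.2 ≤ t} = 0 ∨ τ' {p | p.1 ≤ s ∧ t < p.2} = 0) := by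
  have e1 : τ {p | s < p.1} = τ' {p | s < p.1} := by
    have := congrArg (fun m => m (Ioi s)) h1
    simpa [Measure.map_apply measurable_fst measurableSet_Ioi, preimage] using this
  have e2 : τ {p | t < p.2} = τ' {p | t < p.2} := by
    have := congrArg (fun m => m (Ioi t)) h2
    simpa [Measure.map_apply measurable_snd measurableSet_Ioi, preimage] using this
  have d1 : ∀ ρ : Measure (ℝ × ℝ), ρ {p | s < p.1} =
      ρ {p | s < p.1 ∧ t < p.2} + ρ {p | s < p.1 ∧ p.2 ≤ t} := by
    intro ρ
    rw [← measure_inter_add_sdiff {p : ℝ × ℝ | s < p.1}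
      (measurableSet_lt measurable_const measurable_snd : MeasurableSet {p : ℝ × ℝ | t < p.2})]
    congr 2
    ext p; simp
  have d2 : ∀ ρ : Measure (ℝ × ℝ), ρ {p | t < p.2} =
      ρ {p | s < p.1 ∧ t < p.2} + ρ {p | p.1 ≤ s ∧ t < p.2} := by
    intro ρ
    rw [← measure_inter_add_sdiff {p : ℝ × ℝ | t < p.2}
      (measurableSet_lt measurable_const measurable_fst : MeasurableSet {p : ℝ × ℝ | s < p.1})]
    congr 2
    · ext p; simp [and_comm]
    · ext p; simp [and_comm]
  rcases hm s t with h | h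
  · have e : τ {p | s < p.1 ∧ t < p.2} =
        τ' {p | s < p.1 ∧ t < p.2} + τ' {p | s < p.1 ∧ p.2 ≤ t} := by
      rw [← d1 τ', ← e1, d1 τ, h, add_zero]
    refine ⟨e ▸ le_self_add, fun he hf => Or.inl ?_⟩
    rw [e] at he
    have : τ' {p | s < p.1 ∧ t < p.2} + τ' {p | s < p.1 ∧ p.2 ≤ t} =
      τ' {p | s < p.1 ∧ t < p.2} + 0 := by rw [← he, add_zero]
    exact (ENNReal.add_right_inj hf).1 this
  · have e : τ {p | s < p.1 ∧ t < p.2} =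
        τ' {p | s < p.1 ∧ t < p.2} + τ' {p | p.1 ≤ s ∧ t < p.2} := by
      rw [← d2 τ', ← e2, d2 τ, h, add_zero]
    refine ⟨e ▸ le_self_add, fun he hf => Or.inr ?_⟩
    rw [e] at he
    have : τ' {p | s < p.1 ∧ t < p.2} + τ' {p | p.1 ≤ s ∧ t < p.2} =
      τ' {p | s < p.1 ∧ t < p.2} + 0 := by rw [← he, add_zero]
    exact (ENNReal.add_right_inj hf).1 this

lemma measurableSet_quadS :
    MeasurableSet {w : (ℝ × ℝ) × (ℝ × ℝ) | w.1.1 < w.2.1 ∧ w.1.2 < w.2.2} :=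
  (measurableSet_lt (f := fun w : (ℝ × ℝ) × (ℝ × ℝ) => w.1.1) (g := fun w => w.2.1)
    (by fun_prop) (by fun_prop)).inter
  (measurableSet_lt (f := fun w : (ℝ × ℝ) × (ℝ × ℝ) => w.1.2) (g := fun w => w.2.2)
    (by fun_prop) (by fun_prop))

lemma hoeff (τ : Measure (ℝ × ℝ)) [IsProbabilityMeasure τ] (C : ℝ) :
    ∫⁻ p, ENNReal.ofReal p.1 * ENNReal.ofReal (p.2 + C) ∂τ =
      ∫⁻ st in Ioi (0:ℝ) ×ˢ Ioi (-C), τ {p | st.1 < p.1 ∧ st.2 < p.2} := by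
  have a := Measure.prod_apply (μ := volume.restrict (Ioi (0:ℝ) ×ˢ Ioi (-C))) (ν := τ)
    measurableSet_quadS
  have b := Measure.prod_apply_symm (μ := volume.restrict (Ioi (0:ℝ) ×ˢ Ioi (-C))) (ν := τ)
    measurableSet_quadS
  rw [a] at b
  refine Eq.trans ?_ b.symm
  refine lintegral_congr fun p => ?_
  have : ((fun x : ℝ × ℝ => (x, p)) ⁻¹' {w | w.1.1 < w.2.1 ∧ w.1.2 < w.2.2}) =
      Iio p.1 ×ˢ Iio p.2 := by ext; simp
  rw [this, Measure.restrict_apply (measurableSet_Iio.prod measurableSet_Iio), prod_inter_prod,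
    Measure.volume_eq_prod, Measure.prod_prod, Iio_inter_Ioi, Iio_inter_Ioi, Real.volume_Ioo,
    Real.volume_Ioo]
  simp

lemma core {τ τ' : Measure (ℝ × ℝ)} [IsProbabilityMeasure τ] [IsProbabilityMeasure τ']
    (h1 : τ.map Prod.fst = τ'.map Prod.fst)
    (h2 : τ.map Prod.snd = τ'.map Prod.snd) (hm : QuadMono τ) (A C : ℝ)
    (hb : ∀ᵐ p ∂τ, p ∈ Icc 0 A ×ˢ Icc (-C) C) (hb' : ∀ᵐ p ∂τ', p ∈ Icc 0 A ×ˢ Icc (-C) C) :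
    ∫ p, p.1 * p.2 ∂τ' ≤ ∫ p, p.1 * p.2 ∂τ ∧
    (∫ p, p.1 * p.2 ∂τ ≤ ∫ p, p.1 * p.2 ∂τ' → MonotoneIncrSet (msupport τ')) := by
  have key : ∀ ρ : Measure (ℝ × ℝ), IsProbabilityMeasure ρ →
      (∀ᵐ p ∂ρ, p ∈ Icc 0 A ×ˢ Icc (-C) C) →
      (∫⁻ st in Ioi (0:ℝ) ×ˢ Ioi (-C), ρ {p | st.1 < p.1 ∧ st.2 < p.2}) ≠ ⊤ ∧
      ∫ p, p.1 * p.2 ∂ρ =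
      (∫⁻ st in Ioi (0:ℝ) ×ˢ Ioi (-C), ρ {p | st.1 < p.1 ∧ st.2 < p.2}).toReal
        - C * ∫ x, x ∂(ρ.map Prod.fst) := by
    intro ρ hρ hbρ
    have i1 : Integrable (fun p : ℝ × ℝ => p.1) ρ := by
      refine Integrable.of_bound (by fun_prop) A ?_
      filter_upwards [hbρ] with p hp
      rw [Real.norm_eq_abs, abs_of_nonneg hp.1.1]; exact hp.1.2
    have i2 : Integrable (fun p : ℝ × ℝ => p.1 * (p.2 + C)) ρ := by
      refine Integrable.of_bound (by fun_prop) (A * (C + C)) ?_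
      filter_upwards [hbρ] with p hp
      have h3 := hp.1.1
      have h4 := hp.1.2
      have h5 := hp.2.1
      have h6 := hp.2.2
      rw [Real.norm_eq_abs, abs_of_nonneg (mul_nonneg h3 (by linarith))]
      gcongr
      · linarith
      · linarith
    have n2 : 0 ≤ᵐ[ρ] (fun p : ℝ × ℝ => p.1 * (p.2 + C)) := by
      filter_upwards [hbρ] with p hp
      exact mul_nonneg hp.1.1 (by linarith [hp.2.1])
    have e : ∫⁻ p, ENNReal.ofReal (p.1 * (p.2 + C)) ∂ρ =
        ∫⁻ st in Ioi (0:ℝ) ×ˢ Ioi (-C), ρ {p | st.1 < p.1 ∧ st.2 < p.2} := by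
      rw [← hoeff]
      refine lintegral_congr_ae ?_
      filter_upwards [hbρ] with p hp
      exact ENNReal.ofReal_mul hp.1.1
    have e2 := integral_eq_lintegral_of_nonneg_ae n2 i2.1
    rw [← e, ← e2]
    refine ⟨?_, ?_⟩
    · have := i2.lintegral_lt_top
      exact this.ne
    · rw [integral_map (by fun_prop) (by fun_prop), ← integral_const_mul, ← integral_sub i2 (i1.const_mul C)]
      congr 1; ext p; ring
  obtain ⟨f, g⟩ := key τ inferInstance hb
  obtain ⟨f', g'⟩ := key τ' inferInstance hb'
  have hle : ∀ st : ℝ × ℝ, τ' {p | st.1 < p.1 ∧ st.2 < p.2} ≤ τ {p | st.1 < p.1 ∧ st.2 < p.2} :=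
    fun st => (quad_le h1 h2 hm st.1 st.2).1
  rw [g, g', h1]
  refine ⟨?_, ?_⟩
  · have := ENNReal.toReal_mono f (lintegral_mono
      (μ := volume.restrict (Ioi (0:ℝ) ×ˢ Ioi (-C))) hle)
    linarith
  · intro hge
    have hge : (∫⁻ st in Ioi (0:ℝ) ×ˢ Ioi (-C), τ {p | st.1 < p.1 ∧ st.2 < p.2}) ≤
        ∫⁻ st in Ioi (0:ℝ) ×ˢ Ioi (-C), τ' {p | st.1 < p.1 ∧ st.2 < p.2} := by
      rw [← ENNReal.toReal_le_toReal f f']; linarith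
    have meas : Measurable (fun st : ℝ × ℝ => τ {p | st.1 < p.1 ∧ st.2 < p.2}) :=
      measurable_measure_prodMk_left measurableSet_quadS
    have hae := ae_eq_of_ae_le_of_lintegral_le (Filter.Eventually.of_forall hle) f' meas.aemeasurable hge
    intro p hp q hq hpq
    by_contra! hlt
    have hsup : msupport τ' ⊆ Icc 0 A ×ˢ Icc (-C) C := by
      intro x hx
      refine Measure.support_subset_of_isClosed (isClosed_Icc.prod isClosed_Icc) hb' ?_
      rw [Measure.mem_support_iff_forall]
      exact fun U hU => pos_iff_ne_zero.2 (hx U hU)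
    have hpb := hsup hp
    have hqb := hsup hq
    rw [Filter.EventuallyEq, ae_restrict_iff' (measurableSet_Ioi.prod measurableSet_Ioi)] at hae
    have hopen : IsOpen (Ioo p.1 q.1 ×ˢ Ioo q.2 p.2) := isOpen_Ioo.prod isOpen_Ioo
    have hne : (Ioo p.1 q.1 ×ˢ Ioo q.2 p.2).Nonempty :=
      (nonempty_Ioo.2 hpq).prod (nonempty_Ioo.2 hlt)
    have hpos := hopen.measure_pos (volume : Measure (ℝ × ℝ)) hne
    have hex : ∃ st ∈ Ioo p.1 q.1 ×ˢ Ioo q.2 p.2, st ∈ Ioi (0:ℝ) ×ˢ Ioi (-C) →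
        τ' {p | st.1 < p.1 ∧ st.2 < p.2} = τ {p | st.1 < p.1 ∧ st.2 < p.2} := by
      by_contra! hcon
      refine hpos.ne' (measure_mono_null ?_ hae)
      intro x hx
      obtain ⟨c1, c2⟩ := hcon x hx
      simp only [mem_compl_iff, mem_ofPred_eq]
      exact fun hh => c2 (hh c1)
    obtain ⟨⟨s, t⟩, hst, himp⟩ := hex
    obtain ⟨⟨a1, a2⟩, a3, a4⟩ := hst
    simp only at a1 a2 a3 a4
    have heq := himp ⟨lt_of_le_of_lt hpb.1.1 a1, lt_of_le_of_lt hqb.2.1 a3⟩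
    rcases (quad_le h1 h2 hm s t).2 heq (measure_ne_top _ _) with h | h
    · refine hq (Ioi s ×ˢ Iio t) ((isOpen_Ioi.prod isOpen_Iio).mem_nhds ⟨a2, a3⟩) ?_
      exact measure_mono_null (fun x hx => show s < x.1 ∧ x.2 ≤ t from ⟨hx.1, le_of_lt hx.2⟩) h
    · refine hp (Iio s ×ˢ Ioi t) ((isOpen_Iio.prod isOpen_Ioi).mem_nhds ⟨a1, a4⟩) ?_
      exact measure_mono_null (fun x hx => show x.1 ≤ s ∧ t < x.2 from ⟨le_of_lt hx.1, hx.2⟩) h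

instance : IsProbabilityMeasure lebI := ⟨by simp [lebI]⟩

lemma lebI_eq : lebI = volume.restrict (Ioc (0:ℝ) 1) :=
  (Measure.restrict_congr_set Ioc_ae_eq_Icc).symm

lemma quantile_le_iff (ν : Measure ℝ) [IsProbabilityMeasure ν] (C : ℝ)
    (hC : ∀ᵐ y ∂ν, y ∈ Icc (-C) C) (m : ℝ) (hm : m ∈ Ioc (0:ℝ) 1) (x : ℝ) :
    quantile ν m ≤ x ↔ ENNReal.ofReal m ≤ ν (Iic x) := by
  have hne : {x : ℝ | ENNReal.ofReal m ≤ ν (Iic x)}.Nonempty := by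
    refine ⟨C, ?_⟩
    have : ν (Iic C) = 1 := by
      rw [← prob_compl_eq_zero_iff measurableSet_Iic]
      change ∀ᵐ y ∂ν, y ∈ Iic C
      filter_upwards [hC] with y hy using hy.2
    show ENNReal.ofReal m ≤ ν (Iic C)
    rw [this]
    simpa using hm.2
  have hbd : BddBelow {x : ℝ | ENNReal.ofReal m ≤ ν (Iic x)} := by
    refine ⟨-C, ?_⟩
    intro y hy
    by_contra! hlt
    have h0 : ν (Iic y) = 0 := by
      refine measure_mono_null ?_ hC
      intro z hz hz'
      exact absurd (hz'.1.trans hz) (not_le.2 hlt)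
    have hy : ENNReal.ofReal m ≤ ν (Iic y) := hy
    rw [h0] at hy
    have := hm.1
    simp at hy
    linarith
  constructor
  · intro h
    rw [← ProbabilityTheory.ofReal_cdf]
    apply ENNReal.ofReal_le_ofReal
    have hrc : Filter.Tendsto (ProbabilityTheory.cdf ν) (nhdsWithin x (Ioi x))
        (nhds (ProbabilityTheory.cdf ν x)) :=
      ((ProbabilityTheory.cdf ν).right_continuous x).mono_left (nhdsWithin_mono _ Ioi_subset_Ici_self)
    refine ge_of_tendsto hrc ?_
    filter_upwards [self_mem_nhdsWithin] with y hy
    obtain ⟨z, hz, hzy⟩ := exists_lt_of_csInf_lt hne (lt_of_le_of_lt h hy)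
    have hz : ENNReal.ofReal m ≤ ν (Iic z) := hz
    rw [← ProbabilityTheory.ofReal_cdf,
      ENNReal.ofReal_le_ofReal_iff (ProbabilityTheory.cdf_nonneg _ _)] at hz
    exact hz.trans (ProbabilityTheory.monotone_cdf ν hzy.le)
  · intro h
    exact csInf_le hbd h

lemma quantile_monotoneOn (ν : Measure ℝ) [IsProbabilityMeasure ν] (C : ℝ)
    (hC : ∀ᵐ y ∂ν, y ∈ Icc (-C) C) : MonotoneOn (quantile ν) (Ioc 0 1) := by
  intro m hm m' hm' hmm
  rw [quantile_le_iff ν C hC m hm]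
  exact (ENNReal.ofReal_le_ofReal hmm).trans ((quantile_le_iff ν C hC m' hm' _).1 le_rfl)

lemma quantile_aemeasurable (ν : Measure ℝ) [IsProbabilityMeasure ν] (C : ℝ)
    (hC : ∀ᵐ y ∂ν, y ∈ Icc (-C) C) : AEMeasurable (quantile ν) lebI := by
  rw [lebI_eq]
  exact aemeasurable_restrict_of_monotoneOn measurableSet_Ioc (quantile_monotoneOn ν C hC)

lemma lebI_map_quantile (ν : Measure ℝ) [IsProbabilityMeasure ν] (C : ℝ)
    (hC : ∀ᵐ y ∂ν, y ∈ Icc (-C) C) : lebI.map (quantile ν) = ν := by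
  have hae := quantile_aemeasurable ν C hC
  have : IsProbabilityMeasure (lebI.map (quantile ν)) := Measure.isProbabilityMeasure_map hae
  refine Measure.ext_of_Iic _ _ fun x => ?_
  rw [Measure.map_apply_of_aemeasurable hae measurableSet_Iic]
  have e : (quantile ν ⁻¹' Iic x) =ᵐ[lebI] Iic (ProbabilityTheory.cdf ν x) := by
    rw [lebI_eq]
    filter_upwards [ae_restrict_mem measurableSet_Ioc] with m hm
    have := quantile_le_iff ν C hC m hm x
    rw [← ProbabilityTheory.ofReal_cdf,
      ENNReal.ofReal_le_ofReal_iff (ProbabilityTheory.cdf_nonneg _ _)] at this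
    exact propext this
  rw [measure_congr e, lebI_eq, Measure.restrict_apply measurableSet_Iic, inter_comm,
    Ioc_inter_Iic, min_eq_right (ProbabilityTheory.cdf_le_one _ _), Real.volume_Ioc, sub_zero,
    ProbabilityTheory.ofReal_cdf]

open ProbabilityTheory in
lemma glue {Z : Type*} [MeasurableSpace Z] [StandardBorelSpace Z] (γ : Measure Z)
    [IsProbabilityMeasure γ] (b : Z → ℝ) (hb : Measurable b) (τ : Measure (ℝ × ℝ))
    [IsProbabilityMeasure τ] (h : τ.map Prod.snd = γ.map b) :
    ∃ π : Measure (ℝ × Z), IsProbabilityMeasure π ∧ π.map Prod.snd = γ ∧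
      π.map (fun p => (p.1, b p.2)) = τ := by
  have : Nonempty Z := nonempty_of_isProbabilityMeasure γ
  let K : Kernel ℝ Z := condDistrib id b γ
  have hK : γ.map b ⊗ₘ K = γ.map (fun z => (b z, z)) :=
    compProd_map_condDistrib (X := b) (Y := id) aemeasurable_id
  let P : Measure ((ℝ × ℝ) × Z) := τ ⊗ₘ (K.comap Prod.snd measurable_snd)
  have hP1 : P.map Prod.fst = τ := Measure.fst_compProd _ _
  have hf : Measurable (fun w : (ℝ × ℝ) × Z => (w.1.2, w.2)) := by fun_prop
  have hP2 : P.map (fun w => (w.1.2, w.2)) = γ.map (fun z => (b z, z)) := by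
    rw [← hK, ← h]
    ext s hs
    rw [Measure.map_apply hf hs, Measure.compProd_apply (hf hs), Measure.compProd_apply hs,
      lintegral_map (Kernel.measurable_kernel_prodMk_left hs) measurable_snd]
    rfl
  have hae : ∀ᵐ w ∂P, b w.2 = w.1.2 := by
    have : ∀ᵐ v ∂(P.map (fun w => (w.1.2, w.2))), b v.2 = v.1 := by
      rw [hP2, ae_map_iff (by fun_prop) (measurableSet_eq_fun (by fun_prop) (by fun_prop))]
      simp
    exact ae_of_ae_map hf.aemeasurable this
  have hg : Measurable (fun w : (ℝ × ℝ) × Z => (w.1.1, w.2)) := by fun_prop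
  refine ⟨P.map (fun w => (w.1.1, w.2)), Measure.isProbabilityMeasure_map hg.aemeasurable, ?_, ?_⟩
  · rw [Measure.map_map measurable_snd hg]
    have : (P.map (fun w => (w.1.2, w.2))).map Prod.snd = (γ.map (fun z => (b z, z))).map Prod.snd := by
      rw [hP2]
    rw [Measure.map_map measurable_snd hf, Measure.map_map measurable_snd (by fun_prop)] at this
    refine Eq.trans this ?_
    exact Measure.map_id
  · rw [Measure.map_map (by fun_prop) hg, ← hP1]
    refine Measure.map_congr ?_
    filter_upwards [hae] with w hw
    simp [hw]

/-- comonotone coupling -/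
noncomputable def comon (α : ℝ → ℝ) (ν : Measure ℝ) : Measure (ℝ × ℝ) :=
  lebI.map (fun m => (α m, quantile ν m))

lemma alpha_aemeasurable (α : ℝ → ℝ) (hα_mono : MonotoneOn α (Icc 0 1)) :
    AEMeasurable α lebI :=
  aemeasurable_restrict_of_monotoneOn measurableSet_Icc hα_mono

lemma comon_props (α : ℝ → ℝ) (hα_mono : MonotoneOn α (Icc 0 1))
    (ν : Measure ℝ) [IsProbabilityMeasure ν] (C : ℝ) (hC : ∀ᵐ y ∂ν, y ∈ Icc (-C) C) :
    IsProbabilityMeasure (comon α ν) ∧ (comon α ν).map Prod.fst = lebI.map α ∧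
    (comon α ν).map Prod.snd = ν ∧ QuadMono (comon α ν) ∧
    ∫ p, p.1 * p.2 ∂(comon α ν) = specRisk α ν := by
  have ha := alpha_aemeasurable α hα_mono
  have hq := quantile_aemeasurable ν C hC
  have hp : AEMeasurable (fun m => (α m, quantile ν m)) lebI := ha.prodMk hq
  refine ⟨Measure.isProbabilityMeasure_map hp, ?_, ?_, ?_, ?_⟩
  · rw [comon, AEMeasurable.map_map_of_aemeasurable measurable_fst.aemeasurable hp]
    rfl
  · rw [comon, AEMeasurable.map_map_of_aemeasurable measurable_snd.aemeasurable hp]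
    exact lebI_map_quantile ν C hC
  · intro s t
    have m1 : MeasurableSet {p : ℝ × ℝ | s < p.1 ∧ p.2 ≤ t} :=
      (measurableSet_lt measurable_const measurable_fst).inter
        (measurableSet_le measurable_snd measurable_const)
    have m2 : MeasurableSet {p : ℝ × ℝ | p.1 ≤ s ∧ t < p.2} :=
      (measurableSet_le measurable_fst measurable_const).inter
        (measurableSet_lt measurable_const measurable_snd)
    rw [comon, Measure.map_apply_of_aemeasurable hp m1, Measure.map_apply_of_aemeasurable hp m2,
      lebI_eq, Measure.restrict_apply' measurableSet_Ioc, Measure.restrict_apply' measurableSet_Ioc]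
    by_contra! hc
    obtain ⟨m, ⟨hm1, hm2⟩, hm⟩ := nonempty_of_measure_ne_zero hc.1
    obtain ⟨n, ⟨hn1, hn2⟩, hn⟩ := nonempty_of_measure_ne_zero hc.2
    simp only at hm1 hm2 hn1 hn2
    have hnm : n ≤ m := by
      by_contra! hlt
      have := hα_mono (Ioc_subset_Icc_self hm) (Ioc_subset_Icc_self hn) hlt.le
      linarith
    have := quantile_monotoneOn ν C hC hn hm hnm
    linarith
  · rw [comon, integral_map hp (by fun_prop)]
    simp only [specRisk, lebI, mul_comm]

lemma prod_bdd (α : ℝ → ℝ) (hα_mono : MonotoneOn α (Icc 0 1))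
    (hα_nonneg : ∀ m ∈ Icc (0:ℝ) 1, 0 ≤ α m)
    (ν : Measure ℝ) (C : ℝ) (hC : ∀ᵐ y ∂ν, y ∈ Icc (-C) C) (τ : Measure (ℝ × ℝ))
    (h1 : τ.map Prod.fst = lebI.map α) (h2 : τ.map Prod.snd = ν) :
    ∀ᵐ p ∂τ, p ∈ Icc 0 (α 1) ×ˢ Icc (-C) C := by
  have a1 : ∀ᵐ x ∂(lebI.map α), x ∈ Icc 0 (α 1) := by
    refine (ae_map_iff (p := fun x => x ∈ Icc 0 (α 1)) (alpha_aemeasurable α hα_mono)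
      measurableSet_Icc).2 ?_
    filter_upwards [ae_restrict_mem measurableSet_Icc] with m hm
    exact ⟨hα_nonneg m hm, hα_mono hm (right_mem_Icc.2 zero_le_one) hm.2⟩
  rw [← h1] at a1
  rw [← h2] at hC
  filter_upwards [ae_of_ae_map measurable_fst.aemeasurable a1,
    ae_of_ae_map measurable_snd.aemeasurable hC] with p hp hp'
  exact ⟨hp, hp'⟩


/-- `π ∈ Γ(μ_0, μ_1, ..., μ_d)` (with `μ_0 = α_# Leb_{[0,1]}`)
maximizes `∫ x_0 b(x_1,...,x_d) dπ` over `Γ(μ_0, ..., μ_d)` iff its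
`(1,...,d)`-marginal `γ` maximizes `γ ↦ R_α(b_# γ)` over `Γ(μ_1,...,μ_d)` and
`τ_π = ((x_0,x) ↦ (x_0, b x))_# π` has monotone increasing support. -/
theorem stmt7 (d : ℕ) (X : Fin d → Type*) [∀ i, MeasurableSpace (X i)]
    [∀ i, TopologicalSpace (X i)] [∀ i, PolishSpace (X i)] [∀ i, BorelSpace (X i)]
    (μ : ∀ i, Measure (X i)) (hμ : ∀ i, IsProbabilityMeasure (μ i))
    (α : ℝ → ℝ) (hα_mono : MonotoneOn α (Icc 0 1))
    (hα_nonneg : ∀ m ∈ Icc (0:ℝ) 1, 0 ≤ α m)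
    (b : (∀ i, X i) → ℝ) (hb_cont : Continuous b) (hb_bdd : ∃ C, ∀ z, |b z| ≤ C)
    (π : Measure (ℝ × ∀ i, X i)) (hπ_prob : IsProbabilityMeasure π)
    (hπ0 : π.map Prod.fst = lebI.map α)
    (hπi : ∀ i, π.map (fun p => p.2 i) = μ i) :
    (∀ π' : Measure (ℝ × ∀ i, X i), IsProbabilityMeasure π' →
        π'.map Prod.fst = lebI.map α → (∀ i, π'.map (fun p => p.2 i) = μ i) →
        ∫ p, p.1 * b p.2 ∂π' ≤ ∫ p, p.1 * b p.2 ∂π) ↔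
    ((∀ γ' : Measure (∀ i, X i), IsProbabilityMeasure γ' →
        (∀ i, γ'.map (fun z => z i) = μ i) →
        specRisk α (γ'.map b) ≤ specRisk α ((π.map Prod.snd).map b)) ∧
      MonotoneIncrSet (msupport (π.map (fun p => (p.1, b p.2))))) := by
  obtain ⟨C, hC⟩ := hb_bdd
  have hbm : Measurable b := hb_cont.measurable
  have hνC : ∀ γ : Measure (∀ i, X i), ∀ᵐ y ∂(γ.map b), y ∈ Icc (-C) C := by
    intro γ
    refine (ae_map_iff (p := fun x => x ∈ Icc (-C) C) hbm.aemeasurable measurableSet_Icc).2 ?_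
    exact Filter.Eventually.of_forall fun z => abs_le.1 (hC z)
  have hpm : Measurable (fun p : ℝ × (∀ i, X i) => (p.1, b p.2)) := by fun_prop
  have hIntEq : ∀ ρ : Measure (ℝ × ∀ i, X i), ∫ p, p.1 * b p.2 ∂ρ =
      ∫ p, p.1 * p.2 ∂(ρ.map (fun p => (p.1, b p.2))) := by
    intro ρ
    rw [integral_map hpm.aemeasurable (by fun_prop)]
  have hfst : ∀ ρ : Measure (ℝ × ∀ i, X i),
      (ρ.map (fun p => (p.1, b p.2))).map Prod.fst = ρ.map Prod.fst := by
    intro ρ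
    rw [Measure.map_map measurable_fst hpm]; rfl
  have hsnd : ∀ ρ : Measure (ℝ × ∀ i, X i),
      (ρ.map (fun p => (p.1, b p.2))).map Prod.snd = (ρ.map Prod.snd).map b := by
    intro ρ
    rw [Measure.map_map measurable_snd hpm, Measure.map_map hbm measurable_snd]; rfl
  have hmarg : ∀ (ρ : Measure (ℝ × ∀ i, X i)) (i : Fin d),
      (ρ.map Prod.snd).map (fun z => z i) = ρ.map (fun p => p.2 i) := by
    intro ρ i
    rw [Measure.map_map (measurable_pi_apply i) measurable_snd]; rfl
  -- the upper bound, and the equality cases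
  have upper : ∀ ρ : Measure (ℝ × ∀ i, X i), IsProbabilityMeasure ρ →
      ρ.map Prod.fst = lebI.map α →
      ∫ p, p.1 * b p.2 ∂ρ ≤ specRisk α ((ρ.map Prod.snd).map b) ∧
      (specRisk α ((ρ.map Prod.snd).map b) ≤ ∫ p, p.1 * b p.2 ∂ρ →
        MonotoneIncrSet (msupport (ρ.map (fun p => (p.1, b p.2))))) ∧
      (MonotoneIncrSet (msupport (ρ.map (fun p => (p.1, b p.2)))) →
        specRisk α ((ρ.map Prod.snd).map b) ≤ ∫ p, p.1 * b p.2 ∂ρ) := by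
    intro ρ hρ h0
    have : IsProbabilityMeasure (ρ.map Prod.snd) :=
      Measure.isProbabilityMeasure_map measurable_snd.aemeasurable
    have : IsProbabilityMeasure ((ρ.map Prod.snd).map b) :=
      Measure.isProbabilityMeasure_map hbm.aemeasurable
    have : IsProbabilityMeasure (ρ.map (fun p => (p.1, b p.2))) :=
      Measure.isProbabilityMeasure_map hpm.aemeasurable
    obtain ⟨c0, c1, c2, c3, c4⟩ := comon_props α hα_mono ((ρ.map Prod.snd).map b) C (hνC _)
    have b1 := prod_bdd α hα_mono hα_nonneg _ C (hνC _) _ c1 c2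
    have b2 := prod_bdd α hα_mono hα_nonneg _ C (hνC _) _ ((hfst ρ).trans h0) (hsnd ρ)
    have e1 := c1.trans ((hfst ρ).trans h0).symm
    have e2 := c2.trans (hsnd ρ).symm
    obtain ⟨k1, k2⟩ := core e1 e2 c3 (α 1) C b1 b2
    rw [hIntEq, ← c4]
    refine ⟨k1, k2, fun hmono => ?_⟩
    exact (core e1.symm e2.symm (quadMono_of_msupport _ hmono) (α 1) C b2 b1).1
  have attain : ∀ γ' : Measure (∀ i, X i), IsProbabilityMeasure γ' →
      ∃ ρ : Measure (ℝ × ∀ i, X i), IsProbabilityMeasure ρ ∧ ρ.map Prod.fst = lebI.map α ∧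
        ρ.map Prod.snd = γ' ∧ ∫ p, p.1 * b p.2 ∂ρ = specRisk α (γ'.map b) := by
    intro γ' hγ'
    have : IsProbabilityMeasure (γ'.map b) := Measure.isProbabilityMeasure_map hbm.aemeasurable
    obtain ⟨c0, c1, c2, c3, c4⟩ := comon_props α hα_mono (γ'.map b) C (hνC _)
    obtain ⟨ρ, r0, r1, r2⟩ := glue γ' b hbm _ c2
    refine ⟨ρ, r0, ?_, r1, ?_⟩
    · rw [← hfst, r2, c1]
    · rw [hIntEq, r2, c4]
  have hγp : IsProbabilityMeasure (π.map Prod.snd) :=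
    Measure.isProbabilityMeasure_map measurable_snd.aemeasurable
  obtain ⟨u1, u2, u3⟩ := upper π hπ_prob hπ0
  constructor
  · intro hopt
    have hall : ∀ γ' : Measure (∀ i, X i), IsProbabilityMeasure γ' →
        (∀ i, γ'.map (fun z => z i) = μ i) →
        specRisk α (γ'.map b) ≤ ∫ p, p.1 * b p.2 ∂π := by
      intro γ' hγ' hm
      obtain ⟨ρ, r0, r1, r2, r3⟩ := attain γ' hγ'
      rw [← r3]
      refine hopt ρ r0 r1 fun i => ?_
      rw [← hmarg, r2, hm]
    exact ⟨fun γ' hγ' hm => (hall γ' hγ' hm).trans u1,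
      u2 (hall _ hγp fun i => (hmarg π i).trans (hπi i))⟩
  · rintro ⟨hmax, hmono⟩ π' hπ' h0 hi
    have : IsProbabilityMeasure (π'.map Prod.snd) :=
      Measure.isProbabilityMeasure_map measurable_snd.aemeasurable
    exact ((upper π' hπ' h0).1.trans
      (hmax _ inferInstance fun i => (hmarg π' i).trans (hi i))).trans (u3 hmono)
end

section
/- Let X_1, ..., X_d be compact Polish spaces. For each i and each k ∈ ℕ let μ_i^k ∈ P(X_i) converge weakly to μ_i ∈ P(X_i). Let b^k : X_1 × ... × X_d → ℝ be continuous, converging uniformly to a continuous b that is bounded above by a constant C and bounded below by a sum Σ_i u_i(x_i) with each u_i ∈ L¹(μ_i). Let α^k : [0,1] → [0,∞) be nondecreasing spectral functions uniformly bounded by M, with α^k_# Leb_{[0,1]} converging weakly to α_# Leb_{[0,1]} for a bounded nondecreasing α. Then max_{γ ∈ Γ(μ_1^k, ..., μ_d^k)} R_{α^k}(b^k_# γ) → max_{γ ∈ Γ(μ_1, ..., μ_d)} R_α(b_# γ) as k → ∞. Moreover, if γ^k maximizes R_{α^k}(b^k_# ·) over Γ(μ_1^k, ..., μ_d^k), then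 the weak limit of any weakly convergent subsequence of (γ^k) maximizes R_α(b_# ·) over Γ(μ_1, ..., μ_d). -/
open MeasureTheory Set

/-- Weak convergence of measures: convergence of integrals of bounded continuous
functions. -/
def WeakTendsto {X : Type*} [TopologicalSpace X] [MeasurableSpace X]
    (μk : ℕ → Measure X) (μ : Measure X) : Prop :=
  ∀ f : X → ℝ, Continuous f → (∃ C, ∀ x, |f x| ≤ C) →
    Filter.Tendsto (fun k => ∫ x, f x ∂(μk k)) Filter.atTop (nhds (∫ x, f x ∂μ))


open Filter Topology

section Quant

lemma q_nonempty (μ : Measure ℝ) [IsProbabilityMeasure μ] {m : ℝ} (hm : m < 1) :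
    {x : ℝ | ENNReal.ofReal m ≤ μ (Iic x)}.Nonempty := by
  have h := tendsto_measure_Iic_atTop μ
  rw [measure_univ] at h
  have : ENNReal.ofReal m < 1 := by
    rw [← ENNReal.ofReal_one]; exact (ENNReal.ofReal_lt_ofReal_iff one_pos).2 hm
  obtain ⟨x, hx⟩ := (h.eventually (lt_mem_nhds this)).exists
  exact ⟨x, hx.le⟩

lemma q_bdd (μ : Measure ℝ) [IsProbabilityMeasure μ] {m : ℝ} (hm : 0 < m) :
    BddBelow {x : ℝ | ENNReal.ofReal m ≤ μ (Iic x)} := by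
  have h := ProbabilityTheory.tendsto_cdf_atBot μ
  obtain ⟨x, hx⟩ := (h.eventually (gt_mem_nhds hm)).exists
  rw [ProbabilityTheory.cdf_eq_real, ← not_le, Measure.real,
    ← ENNReal.ofReal_le_iff_le_toReal (measure_ne_top μ _), not_le] at hx
  refine ⟨x, fun y hy => ?_⟩
  by_contra! hlt
  have : μ (Iic y) ≤ μ (Iic x) := measure_mono (Iic_subset_Iic.2 hlt.le)
  exact absurd hx (not_lt.2 (le_trans hy this))

lemma q_le (μ : Measure ℝ) [IsProbabilityMeasure μ] {m x : ℝ} (hm : 0 < m)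
    (h : ENNReal.ofReal m ≤ μ (Iic x)) : quantile μ m ≤ x :=
  csInf_le (q_bdd μ hm) h

lemma le_q (μ : Measure ℝ) [IsProbabilityMeasure μ] {m x : ℝ} (hm : m < 1)
    (h : μ (Iic x) < ENNReal.ofReal m) : x ≤ quantile μ m := by
  refine le_csInf (q_nonempty μ hm) fun y hy => ?_
  by_contra! hlt
  have : μ (Iic y) ≤ μ (Iic x) := measure_mono (Iic_subset_Iic.2 hlt.le)
  exact absurd h (not_lt.2 (le_trans hy this))

lemma q_mono (μ : Measure ℝ) [IsProbabilityMeasure μ] :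
    MonotoneOn (quantile μ) (Ioo 0 1) := by
  intro a ha b hb hab
  refine csInf_le_csInf (q_bdd μ ha.1) (q_nonempty μ hb.2) fun x hx => ?_
  exact le_trans (ENNReal.ofReal_le_ofReal hab) hx

lemma ae_cont_of_monotoneOn {f : ℝ → ℝ} (hf : MonotoneOn f (Ioo 0 1)) :
    ∀ᵐ m ∂(volume.restrict (Icc (0:ℝ) 1)), m ∈ Ioo (0:ℝ) 1 ∧ ContinuousAt f m := by
  have hc := hf.countable_not_continuousWithinAt
  rw [← restrict_Ioo_eq_restrict_Icc, ae_restrict_iff' measurableSet_Ioo]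
  have := hc.ae_notMem volume
  filter_upwards [this] with m hm hm2
  refine ⟨hm2, ?_⟩
  by_contra hcon
  refine hm ⟨hm2, fun h => hcon (h.continuousAt (Ioo_mem_nhds hm2.1 hm2.2))⟩

/-- piecewise linear cutoff -/
lemma cutoff_exists {a b : ℝ} (hab : a < b) : ∃ f : ℝ → ℝ, Continuous f ∧ (∀ x, 0 ≤ f x ∧ f x ≤ 1) ∧
    (∀ x ≤ a, f x = 1) ∧ (∀ x, b < x → f x = 0) := by
  refine ⟨fun x => max 0 (min 1 ((b - x) / (b - a))), by fun_prop, fun x => ⟨by simp, by simp⟩,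
    fun x hx => ?_, fun x hx => ?_⟩
  · have : 1 ≤ (b - x) / (b - a) := by rw [le_div_iff₀ (by linarith)]; linarith
    simp [this]
  · have : (b - x) / (b - a) ≤ 0 := div_nonpos_of_nonpos_of_nonneg (by linarith) (by linarith)
    refine max_eq_left ?_
    exact le_trans (min_le_right _ _) this

lemma real_Iic_le_integral (μ : Measure ℝ) [IsProbabilityMeasure μ] {a : ℝ} {f : ℝ → ℝ}
    (hf : Continuous f) (h01 : ∀ x, 0 ≤ f x ∧ f x ≤ 1) (h1 : ∀ x ≤ a, f x = 1) :
    μ.real (Iic a) ≤ ∫ x, f x ∂μ := by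
  rw [← integral_indicator_one measurableSet_Iic]
  refine integral_mono ?_ ?_ fun x => ?_
  · exact (integrable_const (1:ℝ)).indicator measurableSet_Iic
  · refine Integrable.of_bound hf.aestronglyMeasurable 1 (Eventually.of_forall fun x => ?_)
    rw [Real.norm_eq_abs, abs_of_nonneg (h01 x).1]; exact (h01 x).2
  · by_cases hx : x ≤ a
    · simp [hx, h1 x hx]
    · simp [hx, (h01 x).1]

lemma integral_le_real_Iic (μ : Measure ℝ) [IsProbabilityMeasure μ] {b : ℝ} {f : ℝ → ℝ}
    (hf : Continuous f) (h01 : ∀ x, 0 ≤ f x ∧ f x ≤ 1) (h0 : ∀ x, b < x → f x = 0) :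
    ∫ x, f x ∂μ ≤ μ.real (Iic b) := by
  rw [← integral_indicator_one measurableSet_Iic]
  refine integral_mono ?_ ?_ fun x => ?_
  · refine Integrable.of_bound hf.aestronglyMeasurable 1 (Eventually.of_forall fun x => ?_)
    rw [Real.norm_eq_abs, abs_of_nonneg (h01 x).1]; exact (h01 x).2
  · exact (integrable_const (1:ℝ)).indicator measurableSet_Iic
  · by_cases hx : x ≤ b
    · simp [hx, (h01 x).2]
    · simp [hx, h0 x (not_le.1 hx)]

lemma ofReal_le_iff_real (μ : Measure ℝ) [IsProbabilityMeasure μ] (s : Set ℝ) (m : ℝ) :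
    ENNReal.ofReal m ≤ μ s ↔ m ≤ μ.real s :=
  ENNReal.ofReal_le_iff_le_toReal (measure_ne_top μ s)

lemma lt_ofReal_iff_real (μ : Measure ℝ) [IsProbabilityMeasure μ] (s : Set ℝ) (m : ℝ) :
    μ s < ENNReal.ofReal m ↔ μ.real s < m := by
  rw [← not_le, ofReal_le_iff_real, not_le]

lemma weak_bdd_test {μk : ℕ → Measure ℝ} {μ : Measure ℝ} (h : WeakTendsto μk μ) {f : ℝ → ℝ}
    (hf : Continuous f) (h01 : ∀ x, 0 ≤ f x ∧ f x ≤ 1) :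
    Tendsto (fun k => ∫ x, f x ∂(μk k)) atTop (𝓝 (∫ x, f x ∂μ)) :=
  h f hf ⟨1, fun x => by rw [abs_of_nonneg (h01 x).1]; exact (h01 x).2⟩

lemma q_tendsto {μk : ℕ → Measure ℝ} {μ : Measure ℝ} [∀ k, IsProbabilityMeasure (μk k)]
    [IsProbabilityMeasure μ] (h : WeakTendsto μk μ) {m : ℝ} (hm : m ∈ Ioo (0:ℝ) 1)
    (hc : ContinuousAt (quantile μ) m) :
    Tendsto (fun k => quantile (μk k) m) atTop (𝓝 (quantile μ m)) := by
  set q := quantile μ m with hq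
  have key : ∀ ε > 0, ∀ᶠ k in atTop, q - 2 * ε ≤ quantile (μk k) m ∧
      quantile (μk k) m ≤ q + 2 * ε := by
    intro ε hε
    have hI : Ioo (0:ℝ) 1 ∈ 𝓝 m := Ioo_mem_nhds hm.1 hm.2
    have h1 : ∀ᶠ m' in 𝓝 m, q - ε < quantile μ m' := hc.eventually (lt_mem_nhds (by linarith))
    have h2 : ∀ᶠ m' in 𝓝 m, quantile μ m' < q + ε := hc.eventually (gt_mem_nhds (by linarith))
    have h3 := (h1.and h2).and hI
    obtain ⟨m1, ⟨⟨hm1, -⟩, hm1'⟩, hm1lt⟩ :=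
      ((h3.filter_mono nhdsWithin_le_nhds).and (self_mem_nhdsWithin (s := Iio m))).exists
    obtain ⟨m2, ⟨⟨-, hm2⟩, hm2'⟩, hm2lt⟩ :=
      ((h3.filter_mono nhdsWithin_le_nhds).and (self_mem_nhdsWithin (s := Ioi m))).exists
    have A1 : μ.real (Iic (q - ε)) < m1 := by
      rw [← lt_ofReal_iff_real]
      by_contra! hcon
      exact absurd hm1 (not_lt.2 (q_le μ hm1'.1 hcon))
    have A2 : m2 ≤ μ.real (Iic (q + ε)) := by
      rw [← ofReal_le_iff_real]
      by_contra! hcon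
      exact absurd hm2 (not_lt.2 (le_q μ hm2'.2 hcon))
    obtain ⟨f, hf, hf01, hf1, hf0⟩ := cutoff_exists (show q - 2 * ε < q - ε by linarith)
    obtain ⟨g, hg, hg01, hg1, hg0⟩ := cutoff_exists (show q + ε < q + 2 * ε by linarith)
    have B1 : ∫ x, f x ∂μ < m := by
      have := integral_le_real_Iic μ hf hf01 hf0
      have hm1lt : m1 < m := hm1lt
      linarith
    have B2 : m < ∫ x, g x ∂μ := by
      have := real_Iic_le_integral μ hg hg01 hg1
      have hm2lt : m < m2 := hm2lt
      linarith
    filter_upwards [(weak_bdd_test h hf hf01).eventually (gt_mem_nhds B1),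
      (weak_bdd_test h hg hg01).eventually (lt_mem_nhds B2)] with k hk1 hk2
    constructor
    · refine le_q _ hm.2 ?_
      rw [lt_ofReal_iff_real]
      exact lt_of_le_of_lt (real_Iic_le_integral _ hf hf01 hf1) hk1
    · refine q_le _ hm.1 ?_
      rw [ofReal_le_iff_real]
      exact hk2.le.trans (integral_le_real_Iic _ hg hg01 hg0)
  rw [Metric.tendsto_nhds]
  intro ε hε
  filter_upwards [key (ε / 4) (by linarith)] with k hk
  rw [Real.dist_eq, abs_lt]
  constructor <;> linarith [hk.1, hk.2]

lemma spec_aemeas {α : ℝ → ℝ} (h : MonotoneOn α (Icc 0 1)) : AEMeasurable α lebI :=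
  aemeasurable_restrict_of_monotoneOn measurableSet_Icc h

instance lebI_prob : IsProbabilityMeasure lebI := ⟨by simp [lebI]⟩

lemma q_map_spec {α : ℝ → ℝ} (h : MonotoneOn α (Icc 0 1)) {m : ℝ} (hm : m ∈ Ioo (0:ℝ) 1)
    (hc : ContinuousAt α m) : quantile (lebI.map α) m = α m := by
  have hmeas := spec_aemeas h
  have : IsProbabilityMeasure (lebI.map α) := Measure.isProbabilityMeasure_map hmeas
  have hmI : m ∈ Icc (0:ℝ) 1 := ⟨hm.1.le, hm.2.le⟩
  apply le_antisymm
  · refine q_le _ hm.1 ?_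
    rw [Measure.map_apply_of_aemeasurable hmeas measurableSet_Iic]
    calc ENNReal.ofReal m = lebI (Icc 0 m) := by
          rw [lebI, Measure.restrict_apply measurableSet_Icc,
            inter_eq_left.2 (Icc_subset_Icc_right hm.2.le), Real.volume_Icc, sub_zero]
      _ = lebI (Icc 0 m) := rfl
      _ ≤ _ := measure_mono fun x hx => h ⟨hx.1, hx.2.trans hm.2.le⟩ hmI hx.2
  · refine le_of_forall_lt fun y hy => ?_
    obtain ⟨y', hyy', hy'⟩ := exists_between hy
    refine lt_of_lt_of_le hyy' ?_
    have h1 : ∀ᶠ m' in 𝓝 m, y' < α m' := hc.eventually (lt_mem_nhds hy')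
    obtain ⟨m1, ⟨hm1, hm1'⟩, hm1lt⟩ :=
      (((h1.and (Ioo_mem_nhds hm.1 hm.2)).filter_mono nhdsWithin_le_nhds).and
        (self_mem_nhdsWithin (s := Iio m))).exists
    have hm1lt : m1 < m := hm1lt
    refine le_q _ hm.2 ?_
    rw [Measure.map_apply_of_aemeasurable hmeas measurableSet_Iic]
    calc lebI (α ⁻¹' Iic y') ≤ volume (Icc 0 m1) := by
          rw [lebI, Measure.restrict_apply' measurableSet_Icc]
          refine measure_mono fun x hx => ⟨hx.2.1, ?_⟩
          by_contra! hlt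
          have := h ⟨hm1'.1.le, hm1'.2.le⟩ hx.2 hlt.le
          have h3 : α x ≤ y' := hx.1
          linarith
      _ = ENNReal.ofReal m1 := by simp
      _ < ENNReal.ofReal m := (ENNReal.ofReal_lt_ofReal_iff hm.1).2 hm1lt

lemma q_bound (μ : Measure ℝ) [IsProbabilityMeasure μ] {B m : ℝ} (hm : m ∈ Ioo (0:ℝ) 1)
    (h : ∀ᵐ x ∂μ, |x| ≤ B) : |quantile μ m| ≤ B := by
  rw [abs_le]
  constructor
  · refine le_of_forall_lt fun y hy => ?_
    obtain ⟨y', hyy', hy'⟩ := exists_between hy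
    refine lt_of_lt_of_le hyy' (le_q _ hm.2 ?_)
    have : μ (Iic y') = 0 := by
      refine measure_mono_null (fun x hx => ?_) h
      intro hcon
      have hcon : |x| ≤ B := hcon
      have := (abs_le.1 hcon).1
      have hx : x ≤ y' := hx
      linarith
    rw [this]; exact ENNReal.ofReal_pos.2 hm.1
  · refine q_le _ hm.1 ?_
    have : μ (Iic B) = 1 := by
      refine (prob_compl_eq_zero_iff measurableSet_Iic).1 (measure_mono_null (fun x hx => ?_) h)
      intro hcon
      exact hx ((le_abs_self x).trans hcon)
    rw [this, ← ENNReal.ofReal_one]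
    exact ENNReal.ofReal_le_ofReal hm.2.le

lemma q_aesm (μ : Measure ℝ) [IsProbabilityMeasure μ] :
    AEStronglyMeasurable (quantile μ) (volume.restrict (Icc (0:ℝ) 1)) := by
  rw [← restrict_Ioo_eq_restrict_Icc]
  exact (aemeasurable_restrict_of_monotoneOn measurableSet_Ioo (q_mono μ)).aestronglyMeasurable

lemma specRisk_bound {α : ℝ → ℝ} {M B : ℝ} (μ : Measure ℝ) [IsProbabilityMeasure μ]
    (h : ∀ᵐ x ∂μ, |x| ≤ B) (h0 : ∀ m ∈ Icc (0:ℝ) 1, 0 ≤ α m) (hM : ∀ m ∈ Icc (0:ℝ) 1, α m ≤ M) :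
    |specRisk α μ| ≤ B * M := by
  have hae : ∀ᵐ m ∂(volume.restrict (Icc (0:ℝ) 1)), ‖quantile μ m * α m‖ ≤ B * M := by
    filter_upwards [ae_cont_of_monotoneOn (q_mono μ)] with m hm
    have hm' : m ∈ Icc (0:ℝ) 1 := Ioo_subset_Icc_self hm.1
    have hb := q_bound μ hm.1 h
    rw [norm_mul, Real.norm_eq_abs, Real.norm_eq_abs, abs_of_nonneg (h0 m hm')]
    exact mul_le_mul hb (hM m hm') (h0 m hm') ((abs_nonneg _).trans hb)
  have := norm_integral_le_of_norm_le_const hae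
  simpa [specRisk] using this

lemma specRisk_tendsto {μk : ℕ → Measure ℝ} {μ : Measure ℝ} [∀ k, IsProbabilityMeasure (μk k)]
    [IsProbabilityMeasure μ] (h : WeakTendsto μk μ) {B : ℝ}
    (hB : ∀ᶠ k in atTop, ∀ᵐ x ∂(μk k), |x| ≤ B)
    {αk : ℕ → ℝ → ℝ} {α : ℝ → ℝ} {M : ℝ}
    (hαk_mono : ∀ k, MonotoneOn (αk k) (Icc 0 1))
    (hαk_nonneg : ∀ k, ∀ m ∈ Icc (0:ℝ) 1, 0 ≤ αk k m)
    (hαk_bdd : ∀ k, ∀ m ∈ Icc (0:ℝ) 1, αk k m ≤ M)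
    (hα_mono : MonotoneOn α (Icc 0 1))
    (hα_weak : WeakTendsto (fun k => lebI.map (αk k)) (lebI.map α)) :
    Tendsto (fun k => specRisk (αk k) (μk k)) atTop (𝓝 (specRisk α μ)) := by
  have : ∀ k, IsProbabilityMeasure (lebI.map (αk k)) := fun k =>
    Measure.isProbabilityMeasure_map (spec_aemeas (hαk_mono k))
  have : IsProbabilityMeasure (lebI.map α) := Measure.isProbabilityMeasure_map (spec_aemeas hα_mono)
  have hαae : ∀ᵐ m ∂(volume.restrict (Icc (0:ℝ) 1)), ∀ k, ContinuousAt (αk k) m := by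
    rw [ae_all_iff]; intro k
    exact (ae_cont_of_monotoneOn ((hαk_mono k).mono Ioo_subset_Icc_self)).mono fun m hm => hm.2
  refine tendsto_integral_filter_of_dominated_convergence (fun _ => B * M) ?_ ?_ ?_ ?_
  · exact Eventually.of_forall fun k => (q_aesm (μk k)).mul (spec_aemeas (hαk_mono k)).aestronglyMeasurable
  · filter_upwards [hB] with k hk
    filter_upwards [ae_cont_of_monotoneOn (q_mono μ)] with m hm
    have hm' : m ∈ Icc (0:ℝ) 1 := Ioo_subset_Icc_self hm.1
    have hb := q_bound (μk k) hm.1 hk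
    rw [norm_mul, Real.norm_eq_abs, Real.norm_eq_abs, abs_of_nonneg (hαk_nonneg k m hm')]
    exact mul_le_mul hb (hαk_bdd k m hm') (hαk_nonneg k m hm') ((abs_nonneg _).trans hb)
  · exact integrable_const _
  · filter_upwards [ae_cont_of_monotoneOn (q_mono μ), ae_cont_of_monotoneOn (q_mono (lebI.map α)),
      ae_cont_of_monotoneOn (hα_mono.mono Ioo_subset_Icc_self), hαae] with m h1 h2 h3 h4
    refine (q_tendsto h h1.1 h1.2).mul ?_
    have h5 := q_tendsto hα_weak h1.1 h2.2
    rw [q_map_spec hα_mono h1.1 h3.2] at h5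
    refine h5.congr fun k => ?_
    exact q_map_spec (hαk_mono k) h1.1 (h4 k)

end Quant

section Coupling

open scoped ENNReal

lemma exists_partition {X : Type*} [MetricSpace X] [CompactSpace X] {δ : ℝ} (hδ : 0 < δ) :
    ∃ (s : Finset X) (φ : X → X → ℝ), (∀ c, Continuous (φ c)) ∧ (∀ c x, 0 ≤ φ c x) ∧
      (∀ x, ∑ c ∈ s, φ c x = 1) ∧ (∀ c x y, δ ≤ dist x y → φ c x * φ c y = 0) := by
  obtain ⟨t, -, htf, hcov⟩ := finite_cover_balls_of_compact (isCompact_univ (X := X))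
    (half_pos hδ)
  set s := htf.toFinset with hs
  let ψ : X → X → ℝ := fun c x => max 0 (δ / 2 - dist x c)
  have hψc : ∀ c, Continuous (ψ c) := fun c => by fun_prop
  have hψ0 : ∀ c x, 0 ≤ ψ c x := fun c x => le_max_left _ _
  have hS : ∀ x, 0 < ∑ c ∈ s, ψ c x := by
    intro x
    have hx := hcov (mem_univ x)
    simp only [mem_iUnion, Metric.mem_ball] at hx
    obtain ⟨c, hc, hxc⟩ := hx
    refine Finset.sum_pos' (fun c _ => hψ0 c x) ⟨c, by simpa [hs] using hc, ?_⟩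
    exact lt_max_of_lt_right (by linarith)
  refine ⟨s, fun c x => ψ c x / ∑ c ∈ s, ψ c x, fun c => ?_, fun c x => ?_, fun x => ?_,
    fun c x y hxy => ?_⟩
  · exact (hψc c).div (continuous_finsetSum _ fun c _ => hψc c) fun x => (hS x).ne'
  · exact div_nonneg (hψ0 c x) (hS x).le
  · rw [← Finset.sum_div, div_self (hS x).ne']
  · have : ψ c x = 0 ∨ ψ c y = 0 := by
      by_contra! hcon
      have h1 : 0 < δ / 2 - dist x c := by
        by_contra! h; exact hcon.1 (max_eq_left h)
      have h2 : 0 < δ / 2 - dist y c := by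
        by_contra! h; exact hcon.2 (max_eq_left h)
      have := dist_triangle_right x y c
      linarith
    rcases this with h | h <;> simp [h]

lemma cont_integrable {X : Type*} [TopologicalSpace X] [CompactSpace X] [MeasurableSpace X]
    [OpensMeasurableSpace X] (ν : Measure X) [IsFiniteMeasure ν] {f : X → ℝ} (hf : Continuous f) :
    Integrable f ν := by
  obtain ⟨C, hC⟩ := isCompact_univ.exists_bound_of_continuousOn hf.continuousOn
  exact Integrable.of_bound hf.measurable.aestronglyMeasurable C
    (Eventually.of_forall fun x => hC x (mem_univ x))

lemma exists_density {X : Type*} [MetricSpace X] [CompactSpace X] [MeasurableSpace X]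
    [BorelSpace X] {νk : ℕ → Measure X} {ν : Measure X} [∀ k, IsProbabilityMeasure (νk k)]
    [IsProbabilityMeasure ν] (h : WeakTendsto νk ν) {δ : ℝ} (hδ : 0 < δ) (hδ1 : δ < 1) :
    ∀ᶠ k in atTop, ∃ D : X → X → ℝ≥0∞, Measurable (fun p : X × X => D p.1 p.2) ∧
      (∀ᵐ x ∂ν, ∫⁻ y, D x y ∂(νk k) = 1) ∧ (∀ y, ∫⁻ x, D x y ∂ν = 1) ∧
      ∫⁻ x, ∫⁻ y, ({p : X × X | δ ≤ dist p.1 p.2}.indicator 1 (x, y)) * D x y ∂(νk k) ∂ν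
        ≤ ENNReal.ofReal δ := by
  obtain ⟨s, φ, hφc, hφ0, hφ1, hφδ⟩ := exists_partition (X := X) hδ
  set c : X → ℝ := fun j => ∫ x, φ j x ∂ν with hc
  have hc0 : ∀ j, 0 ≤ c j := fun j => integral_nonneg (hφ0 j)
  have hcsum : ∑ j ∈ s, c j = 1 := by
    rw [hc, ← integral_finsetSum _ fun j _ => cont_integrable ν (hφc j)]
    simp [hφ1]
  have hev : ∀ᶠ k in atTop, ∀ j ∈ s, 0 < c j → (1 - δ) * c j < ∫ x, φ j x ∂(νk k) := by
    rw [Filter.eventually_all_finset]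
    intro j _
    by_cases hj : 0 < c j
    · have ht := h (φ j) (hφc j) (by
        obtain ⟨C, hC⟩ := isCompact_univ.exists_bound_of_continuousOn (hφc j).continuousOn
        exact ⟨C, fun x => hC x (mem_univ x)⟩)
      have : (1 - δ) * c j < ∫ x, φ j x ∂ν := by
        change (1 - δ) * c j < c j
        nlinarith
      filter_upwards [ht.eventually (lt_mem_nhds this)] with k hk _ using hk
    · exact Eventually.of_forall fun k h => absurd h hj
  filter_upwards [hev] with k hk
  set ck : X → ℝ := fun j => ∫ x, φ j x ∂(νk k) with hck
  have hck0 : ∀ j, 0 ≤ ck j := fun j => integral_nonneg (hφ0 j)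
  set r : X → ℝ := fun y => 1 - (1 - δ) * ∑ j ∈ s, c j * φ j y / ck j with hr
  have hrc : Continuous r := by
    refine continuous_const.sub (continuous_const.mul (continuous_finsetSum _ fun j _ => ?_))
    exact (continuous_const.mul (hφc j)).div_const _
  have hr0 : ∀ y, 0 ≤ r y := by
    intro y
    have : (1 - δ) * ∑ j ∈ s, c j * φ j y / ck j ≤ ∑ j ∈ s, φ j y := by
      rw [Finset.mul_sum]
      refine Finset.sum_le_sum fun j hj => ?_
      rcases (hc0 j).eq_or_lt with h0 | h0
      · rw [← h0]; simp [hφ0]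
      · have h1 := hk j hj h0
        have h2 : 0 < ck j := lt_of_le_of_lt (mul_nonneg (by linarith) h0.le) h1
        rw [← mul_div_assoc, div_le_iff₀ h2]
        have := mul_le_mul_of_nonneg_left h1.le (hφ0 j y)
        nlinarith
    rw [hφ1] at this
    simp only [hr]; linarith
  have hckc : ∀ j ∈ s, c j * (ck j / ck j) = c j := by
    intro j hj
    rcases (hc0 j).eq_or_lt with h0 | h0
    · rw [← h0]; simp
    · have h2 : 0 < ck j := lt_of_le_of_lt (mul_nonneg (by linarith) h0.le) (hk j hj h0)
      rw [div_self h2.ne', mul_one]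
  have hrint : ∫ y, r y ∂(νk k) = δ := by
    have h1 : ∀ j ∈ s, Integrable (fun y => c j * φ j y / ck j) (νk k) := fun j _ =>
      cont_integrable _ ((continuous_const.mul (hφc j)).div_const _)
    simp only [hr]
    rw [integral_sub (integrable_const _) ((integrable_finsetSum _ h1).const_mul _),
      integral_const_mul, integral_finsetSum _ h1]
    have h2 : ∀ j ∈ s, ∫ y, c j * φ j y / ck j ∂(νk k) = c j := by
      intro j hj
      rw [integral_div, integral_const_mul, mul_div_assoc]
      exact hckc j hj
    rw [Finset.sum_congr rfl h2, hcsum]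
    simp
  set Dr : X → X → ℝ := fun x y => (1 - δ) * ∑ j ∈ s, φ j x * φ j y / ck j + r y with hDr
  have hDc : Continuous (fun p : X × X => Dr p.1 p.2) := by
    refine (continuous_const.mul (continuous_finsetSum _ fun j _ => ?_)).add
      (hrc.comp continuous_snd)
    exact (((hφc j).comp continuous_fst).mul ((hφc j).comp continuous_snd)).div_const _
  have hD0 : ∀ x y, 0 ≤ Dr x y := fun x y => by
    refine add_nonneg (mul_nonneg (by linarith) (Finset.sum_nonneg fun j _ => ?_)) (hr0 y)
    exact div_nonneg (mul_nonneg (hφ0 _ _) (hφ0 _ _)) (hck0 j)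
  have hDx : ∀ x, Continuous (Dr x) := fun x => hDc.comp (continuous_const.prodMk continuous_id)
  have hDy : ∀ y, Continuous (fun x => Dr x y) := fun y =>
    hDc.comp (continuous_id.prodMk continuous_const)
  refine ⟨fun x y => ENNReal.ofReal (Dr x y), hDc.measurable.ennreal_ofReal, ?_, ?_, ?_⟩
  · have hz : ∀ᵐ x ∂ν, ∀ j ∈ s, φ j x * (ck j / ck j) = φ j x := by
      rw [Finset.eventually_all]
      intro j hj
      rcases (hc0 j).eq_or_lt with h0 | h0
      · have := (integral_eq_zero_iff_of_nonneg (hφ0 j) (cont_integrable ν (hφc j))).1 h0.symm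
        filter_upwards [this] with x hx
        rw [hx]; simp
      · have h2 : 0 < ck j := lt_of_le_of_lt (mul_nonneg (by linarith) h0.le) (hk j hj h0)
        exact Eventually.of_forall fun x => by rw [div_self h2.ne', mul_one]
    filter_upwards [hz] with x hx
    rw [← ofReal_integral_eq_lintegral_ofReal (cont_integrable _ (hDx x))
      (Eventually.of_forall (hD0 x))]
    have h1 : ∀ j ∈ s, Integrable (fun y => φ j x * φ j y / ck j) (νk k) := fun j _ =>
      cont_integrable _ ((continuous_const.mul (hφc j)).div_const _)
    simp only [hDr]
    rw [integral_add ((integrable_finsetSum _ h1).const_mul _) (cont_integrable _ hrc),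
      integral_const_mul, integral_finsetSum _ h1, hrint]
    have h2 : ∀ j ∈ s, ∫ y, φ j x * φ j y / ck j ∂(νk k) = φ j x := by
      intro j hj
      rw [integral_div, integral_const_mul, mul_div_assoc]
      exact hx j hj
    rw [Finset.sum_congr rfl h2, hφ1]
    simp
  · intro y
    rw [← ofReal_integral_eq_lintegral_ofReal (cont_integrable _ (hDy y))
      (Eventually.of_forall fun x => hD0 x y)]
    have h1 : ∀ j ∈ s, Integrable (fun x => φ j x * φ j y / ck j) ν := fun j _ =>
      cont_integrable _ (((hφc j).mul continuous_const).div_const _)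
    simp only [hDr]
    rw [integral_add ((integrable_finsetSum _ h1).const_mul _) (integrable_const _),
      integral_const_mul, integral_finsetSum _ h1]
    have h2 : ∀ j ∈ s, ∫ x, φ j x * φ j y / ck j ∂ν = c j * φ j y / ck j := by
      intro j hj
      rw [integral_div, integral_mul_const]
    rw [Finset.sum_congr rfl h2]
    simp [hr]
  · calc _ ≤ ∫⁻ x, ∫⁻ y, ENNReal.ofReal (r y) ∂(νk k) ∂ν := by
          refine lintegral_mono fun x => lintegral_mono fun y => ?_
          by_cases hxy : δ ≤ dist x y
          · have : Dr x y = r y := by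
              simp [hDr, hφδ _ x y hxy]
            simp [this]
            exact mul_le_of_le_one_left (by simp) (indicator_le_self _ _ _)
          · simp [hxy]
      _ = ENNReal.ofReal δ := by
          rw [lintegral_const, measure_univ, mul_one,
            ← ofReal_integral_eq_lintegral_ofReal (cont_integrable _ hrc)
            (Eventually.of_forall hr0), hrint]

variable {d : ℕ} {X : Fin d → Type*} [∀ i, MeasurableSpace (X i)]

lemma glue_inner (ν : ∀ i, Measure (X i)) [∀ i, IsProbabilityMeasure (ν i)]
    (E : ∀ i, X i → ℝ≥0∞) (hE : ∀ i, Measurable (E i)) :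
    ∫⁻ y, ∏ j, E j (y j) ∂(Measure.pi ν) = ∏ j, ∫⁻ y, E j y ∂(ν j) := by
  rw [ProbabilityTheory.lintegral_prod_eq_prod_lintegral_of_indepFun Finset.univ
    (fun i (y : ∀ i, X i) => E i (y i))
    (ProbabilityTheory.iIndepFun_pi fun i => (hE i).aemeasurable)
    (fun i => (hE i).comp (measurable_pi_apply i))]
  refine Finset.prod_congr rfl fun i _ => ?_
  exact (measurePreserving_eval ν i).lintegral_comp (hE i)

lemma glue_inner' (ν : ∀ i, Measure (X i)) [∀ i, IsProbabilityMeasure (ν i)]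
    (E : ∀ i, X i → ℝ≥0∞) (hE : ∀ i, Measurable (E i)) (h1 : ∀ i, ∫⁻ y, E i y ∂(ν i) = 1)
    (i : Fin d) (g : X i → ℝ≥0∞) (hg : Measurable g) :
    ∫⁻ y, g (y i) * ∏ j, E j (y j) ∂(Measure.pi ν) = ∫⁻ y, g y * E i y ∂(ν i) := by
  have hF : ∀ j, Measurable (Function.update E i (fun y => g y * E i y) j) := by
    intro j
    by_cases hj : j = i
    · subst hj; rw [Function.update_self]; exact hg.mul (hE j)
    · simpa [Function.update_of_ne hj] using hE j
  have := glue_inner ν (Function.update E i (fun y => g y * E i y)) hF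
  rw [← Finset.mul_prod_erase Finset.univ (fun j => ∫⁻ y, _ ∂(ν j)) (Finset.mem_univ i)] at this
  have h2 : ∏ j ∈ Finset.univ.erase i, ∫⁻ y, Function.update E i (fun y => g y * E i y) j y ∂(ν j)
      = 1 := by
    refine Finset.prod_eq_one fun j hj => ?_
    rw [Function.update_of_ne (Finset.ne_of_mem_erase hj)]
    exact h1 j
  rw [h2, mul_one, Function.update_self] at this
  rw [← this]
  refine lintegral_congr fun y => ?_
  rw [← Finset.mul_prod_erase Finset.univ _ (Finset.mem_univ i),
    ← Finset.mul_prod_erase Finset.univ (fun j => Function.update E i _ j (y j))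
      (Finset.mem_univ i), Function.update_self, mul_assoc]
  congr 2
  refine Finset.prod_congr rfl fun j hj => ?_
  rw [Function.update_of_ne (Finset.ne_of_mem_erase hj)]

lemma exists_glue (μ ν : ∀ i, Measure (X i)) [∀ i, IsProbabilityMeasure (ν i)]
    [∀ i, IsProbabilityMeasure (μ i)]
    (D : ∀ i, X i → X i → ℝ≥0∞) (hD : ∀ i, Measurable (fun p : X i × X i => D i p.1 p.2))
    (h1 : ∀ i, ∀ᵐ x ∂(μ i), ∫⁻ y, D i x y ∂(ν i) = 1) (h2 : ∀ i y, ∫⁻ x, D i x y ∂(μ i) = 1)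
    (γ : Measure (∀ i, X i)) [IsProbabilityMeasure γ] (hγ : ∀ i, γ.map (fun z => z i) = μ i) :
    ∃ P : Measure ((∀ i, X i) × (∀ i, X i)), P.map Prod.fst = γ ∧
      (∀ i, (P.map Prod.snd).map (fun z => z i) = ν i) ∧
      ∀ i (T : Set (X i × X i)), MeasurableSet T → P {p | (p.1 i, p.2 i) ∈ T} =
        ∫⁻ x, ∫⁻ y, T.indicator 1 (x, y) * D i x y ∂(ν i) ∂(μ i) := by
  have hDx : ∀ i x, Measurable (D i x) := fun i x => (hD i).comp measurable_prodMk_left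
  have hprod : Measurable (fun p : (∀ i, X i) × (∀ i, X i) => ∏ j, D j (p.1 j) (p.2 j)) := by
    refine Finset.measurable_prod _ fun j _ => ?_
    exact (hD j).comp (((measurable_pi_apply j).comp measurable_fst).prodMk
      ((measurable_pi_apply j).comp measurable_snd))
  have hae : ∀ᵐ x ∂γ, ∀ i, ∫⁻ y, D i (x i) y ∂(ν i) = 1 := by
    rw [ae_all_iff]
    intro i
    have := h1 i
    rw [← hγ i] at this
    exact ae_of_ae_map (measurable_pi_apply i).aemeasurable this
  set P := (γ.prod (Measure.pi ν)).withDensity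
    (fun p => ∏ j, D j (p.1 j) (p.2 j)) with hP
  have hPT : ∀ S : Set ((∀ i, X i) × (∀ i, X i)), MeasurableSet S →
      P S = ∫⁻ x, ∫⁻ y, S.indicator 1 (x, y) * ∏ j, D j (x j) (y j) ∂(Measure.pi ν) ∂γ := by
    intro S hS
    rw [hP, withDensity_apply _ hS, ← lintegral_indicator hS, lintegral_prod]
    · refine lintegral_congr fun x => lintegral_congr fun y => ?_
      by_cases hxy : (x, y) ∈ S <;> simp [hxy]
    · exact (hprod.indicator hS).aemeasurable
  have h3 : ∀ i (T : Set (X i × X i)), MeasurableSet T → P {p | (p.1 i, p.2 i) ∈ T} =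
        ∫⁻ x, ∫⁻ y, T.indicator 1 (x, y) * D i x y ∂(ν i) ∂(μ i) := by
    intro i T hT
    have hm : Measurable (fun p : (∀ i, X i) × (∀ i, X i) => (p.1 i, p.2 i)) :=
      ((measurable_pi_apply i).comp measurable_fst).prodMk
        ((measurable_pi_apply i).comp measurable_snd)
    have hS : MeasurableSet {p : (∀ i, X i) × (∀ i, X i) | (p.1 i, p.2 i) ∈ T} := hm hT
    rw [hPT _ hS, ← hγ i, lintegral_map _ (measurable_pi_apply i)]
    · refine lintegral_congr_ae ?_
      filter_upwards [hae] with x hx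
      rw [← glue_inner' ν (fun j => D j (x j)) (fun j => hDx j _) hx i
        (fun y => T.indicator 1 (x i, y))]
      · rfl
      · exact (measurable_one.indicator hT).comp measurable_prodMk_left
    · exact Measurable.lintegral_prod_right'
        (f := fun p : X i × X i => T.indicator 1 p * D i p.1 p.2)
        ((measurable_one.indicator hT).mul (hD i))
  refine ⟨P, ?_, ?_, h3⟩
  · ext A hA
    rw [Measure.map_apply measurable_fst hA, hPT _ (measurable_fst hA)]
    rw [← lintegral_indicator_one hA]
    refine lintegral_congr_ae ?_
    filter_upwards [hae] with x hx
    have : ∀ y : (∀ i, X i), (Prod.fst ⁻¹' A).indicator (1 : (∀ i, X i) × (∀ i, X i) → ℝ≥0∞) (x, y)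
        = A.indicator 1 x := fun y => by
      by_cases hxA : x ∈ A <;> simp [hxA]
    simp only [this]
    rw [lintegral_const_mul, glue_inner ν (fun j => D j (x j)) (fun j => hDx j _)]
    · simp [hx]
    · exact hprod.comp measurable_prodMk_left
  · intro i
    ext B hB
    rw [Measure.map_apply (measurable_pi_apply i) hB,
      Measure.map_apply measurable_snd (measurable_pi_apply i hB)]
    have := h3 i (Prod.snd ⁻¹' B) (measurable_snd hB)
    refine this.trans ?_
    rw [lintegral_lintegral_swap]
    · rw [← lintegral_indicator_one hB]
      refine lintegral_congr fun y => ?_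
      have : ∀ x : X i, (Prod.snd ⁻¹' B).indicator (1 : X i × X i → ℝ≥0∞) (x, y)
          = B.indicator 1 y := fun x => by
        by_cases hy : y ∈ B <;> simp [hy]
      simp only [this]
      rw [lintegral_const_mul, h2, mul_one]
      exact (hD i).comp measurable_prodMk_right
    · exact ((measurable_one.indicator (measurable_snd hB)).mul (hD i)).aemeasurable

end Coupling

section Recovery

open scoped ENNReal

lemma weak_of_tendsto {Z : Type*} [TopologicalSpace Z] [MeasurableSpace Z] [OpensMeasurableSpace Z]
    {P : ℕ → ProbabilityMeasure Z} {Q : ProbabilityMeasure Z} (h : Tendsto P atTop (𝓝 Q)) :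
    WeakTendsto (fun k => (P k : Measure Z)) (Q : Measure Z) := by
  intro f hf ⟨C, hC⟩
  rw [ProbabilityMeasure.tendsto_iff_forall_integral_tendsto] at h
  exact h (BoundedContinuousFunction.ofNormedAddCommGroup f hf C hC)

lemma tendsto_of_weak {Z : Type*} [TopologicalSpace Z] [MeasurableSpace Z] [OpensMeasurableSpace Z]
    {P : ℕ → ProbabilityMeasure Z} {Q : ProbabilityMeasure Z}
    (h : WeakTendsto (fun k => (P k : Measure Z)) (Q : Measure Z)) : Tendsto P atTop (𝓝 Q) := by
  rw [ProbabilityMeasure.tendsto_iff_forall_integral_tendsto]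
  intro f
  exact h f f.continuous ⟨‖f‖, fun x => f.norm_coe_le_norm x⟩

lemma recovery_metric {d : ℕ} {X : Fin d → Type*} [∀ i, MeasurableSpace (X i)]
    [∀ i, MetricSpace (X i)] [∀ i, BorelSpace (X i)] [∀ i, CompactSpace (X i)]
    {μk : ℕ → ∀ i, Measure (X i)} {μ : ∀ i, Measure (X i)}
    [∀ k i, IsProbabilityMeasure (μk k i)] [∀ i, IsProbabilityMeasure (μ i)]
    (hμ_weak : ∀ i, WeakTendsto (fun k => μk k i) (μ i))
    (γ : ProbabilityMeasure (∀ i, X i))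
    (hγ : ∀ i, (γ : Measure (∀ i, X i)).map (fun z => z i) = μ i)
    {η : ℝ} (hη : 0 < η) :
    ∀ᶠ k in atTop, ∃ γ' : ProbabilityMeasure (∀ i, X i),
      (∀ i, (γ' : Measure (∀ i, X i)).map (fun z => z i) = μk k i) ∧
      dist (LevyProkhorov.ofMeasure (α := ProbabilityMeasure (∀ i, X i)) γ)
        (LevyProkhorov.ofMeasure (α := ProbabilityMeasure (∀ i, X i)) γ') ≤ η := by
  set δ : ℝ := min (η / (d + 1)) (1 / 2) with hδdef
  have hδ : 0 < δ := lt_min (by positivity) (by norm_num)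
  have hδ1 : δ < 1 := lt_of_le_of_lt (min_le_right _ _) (by norm_num)
  have hdδ : d * δ ≤ η := by
    have : δ ≤ η / (d + 1) := min_le_left _ _
    rw [le_div_iff₀ (by positivity)] at this
    nlinarith
  have hδη : δ ≤ η := by
    have : δ ≤ η / (d + 1) := min_le_left _ _
    rw [le_div_iff₀ (by positivity)] at this
    nlinarith [mul_nonneg hδ.le (Nat.cast_nonneg (α := ℝ) d)]
  have hev : ∀ᶠ k in atTop, ∀ i, _ := Filter.eventually_all.2 fun i =>
    exists_density (hμ_weak i) hδ hδ1
  filter_upwards [hev] with k hk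
  choose D hD h1 h2 h3 using hk
  obtain ⟨P, hP1, hP2, hP3⟩ := exists_glue μ (μk k) D hD h1 h2 (γ : Measure (∀ i, X i)) hγ
  have hPprob : IsProbabilityMeasure P := by
    constructor
    have : P.map Prod.fst univ = 1 := by rw [hP1]; exact measure_univ
    rwa [Measure.map_apply measurable_fst MeasurableSet.univ, preimage_univ] at this
  have hγ'prob : IsProbabilityMeasure (P.map Prod.snd) :=
    Measure.isProbabilityMeasure_map measurable_snd.aemeasurable
  refine ⟨⟨P.map Prod.snd, hγ'prob⟩, hP2, ?_⟩
  rw [LevyProkhorov.dist_probabilityMeasure_def]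
  refine levyProkhorovDist_le_of_forall_le _ _ hη.le fun ε B hε hB => ?_
  change (γ : Measure (∀ i, X i)) B ≤ (P.map Prod.snd) (Metric.thickening ε B) + ENNReal.ofReal ε
  have hbad : P (⋃ i, {p | (p.1 i, p.2 i) ∈ {q : X i × X i | δ ≤ dist q.1 q.2}})
      ≤ ENNReal.ofReal ε := by
    refine (measure_iUnion_fintype_le _ _).trans ?_
    calc _ ≤ ∑ i : Fin d, ENNReal.ofReal δ := by
          refine Finset.sum_le_sum fun i _ => ?_
          rw [hP3 i {q : X i × X i | δ ≤ dist q.1 q.2}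
            (isClosed_le continuous_const continuous_dist).measurableSet]
          exact h3 i
      _ = ENNReal.ofReal (d * δ) := by
          rw [ENNReal.ofReal_mul (by positivity)]; simp
      _ ≤ _ := ENNReal.ofReal_le_ofReal (by linarith)
  calc (γ : Measure (∀ i, X i)) B = P (Prod.fst ⁻¹' B) := by
        rw [← Measure.map_apply measurable_fst hB, hP1]
    _ ≤ P (Prod.snd ⁻¹' (Metric.thickening ε B) ∪
        ⋃ i, {p | (p.1 i, p.2 i) ∈ {q : X i × X i | δ ≤ dist q.1 q.2}}) := by
        refine measure_mono fun p hp => ?_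
        by_cases hbad : ∃ i, δ ≤ dist (p.1 i) (p.2 i)
        · right; exact mem_iUnion.2 hbad
        · left
          push Not at hbad
          have : dist p.2 p.1 < ε := by
            rw [dist_comm]
            exact lt_of_lt_of_le ((dist_pi_lt_iff hδ).2 hbad) (by linarith)
          exact Metric.mem_thickening_iff.2 ⟨p.1, hp, this⟩
    _ ≤ _ := by
        refine (measure_union_le _ _).trans (add_le_add ?_ hbad)
        rw [Measure.map_apply measurable_snd Metric.isOpen_thickening.measurableSet]

lemma recovery {d : ℕ} {X : Fin d → Type*} [∀ i, MeasurableSpace (X i)]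
    [∀ i, TopologicalSpace (X i)] [∀ i, PolishSpace (X i)] [∀ i, BorelSpace (X i)]
    [∀ i, CompactSpace (X i)]
    {μk : ℕ → ∀ i, Measure (X i)} {μ : ∀ i, Measure (X i)}
    [∀ k i, IsProbabilityMeasure (μk k i)] [∀ i, IsProbabilityMeasure (μ i)]
    (hμ_weak : ∀ i, WeakTendsto (fun k => μk k i) (μ i))
    (γ : Measure (∀ i, X i)) [IsProbabilityMeasure γ] (hγ : ∀ i, γ.map (fun z => z i) = μ i) :
    ∃ γk : ℕ → Measure (∀ i, X i), (∀ k, IsProbabilityMeasure (γk k)) ∧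
      (∀ k i, (γk k).map (fun z => z i) = μk k i) ∧ WeakTendsto γk γ := by
  letI : ∀ i, MetricSpace (X i) := fun i => TopologicalSpace.metrizableSpaceMetric (X i)
  let γP : ProbabilityMeasure (∀ i, X i) := ⟨γ, ‹_›⟩
  let γ0 : LevyProkhorov (ProbabilityMeasure (∀ i, X i)) :=
    LevyProkhorov.ofMeasure (α := ProbabilityMeasure (∀ i, X i)) γP
  let G : ℕ → Set (LevyProkhorov (ProbabilityMeasure (∀ i, X i))) := fun k =>
    {Q | ∀ i, (Q.toMeasure : Measure (∀ i, X i)).map (fun z => z i) = μk k i}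
  have hne : ∀ k, (G k).Nonempty := fun k =>
    ⟨LevyProkhorov.ofMeasure (α := ProbabilityMeasure (∀ i, X i)) ⟨Measure.pi (μk k), inferInstance⟩, fun i =>
      (measurePreserving_eval (μk k) i).map_eq⟩
  have hch : ∀ k : ℕ, ∃ Q ∈ G k, dist γ0 Q < Metric.infDist γ0 (G k) + 1 / ((k:ℝ) + 1) := fun k =>
    (Metric.infDist_lt_iff (hne k)).1 (lt_add_of_pos_right _ (by positivity))
  choose Q hQG hQd using hch
  have hinf : Tendsto (fun k => Metric.infDist γ0 (G k)) atTop (𝓝 0) := by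
    rw [Metric.tendsto_nhds]
    intro ε hε
    filter_upwards [recovery_metric hμ_weak γP hγ (half_pos hε)] with k hk
    obtain ⟨γ', h1, h2⟩ := hk
    rw [Real.dist_eq, sub_zero, abs_of_nonneg Metric.infDist_nonneg]
    have : LevyProkhorov.ofMeasure (α := ProbabilityMeasure (∀ i, X i)) γ' ∈ G k := h1
    have := Metric.infDist_le_dist_of_mem (x := γ0) this
    have h3 : dist γ0 (LevyProkhorov.ofMeasure (α := ProbabilityMeasure (∀ i, X i)) γ') ≤ ε / 2 := h2
    linarith
  have hQ : Tendsto Q atTop (𝓝 γ0) := by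
    rw [tendsto_iff_dist_tendsto_zero]
    have hle : ∀ k, dist (Q k) γ0 ≤ Metric.infDist γ0 (G k) + 1 / ((k:ℝ) + 1) := fun k => by
      rw [dist_comm]; exact (hQd k).le
    refine squeeze_zero (fun _ => dist_nonneg) hle ?_
    simpa using hinf.add tendsto_one_div_add_atTop_nhds_zero_nat
  have hQ' := (LevyProkhorov.continuous_toMeasure_probabilityMeasure.tendsto γ0).comp hQ
  refine ⟨fun k => (Q k).toMeasure, fun k => inferInstance, fun k i => hQG k i, ?_⟩
  exact weak_of_tendsto hQ'

lemma weak_map {Z : Type*} [TopologicalSpace Z] [CompactSpace Z] [MeasurableSpace Z] [BorelSpace Z]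
    {γk : ℕ → Measure Z} {γ : Measure Z} [∀ k, IsProbabilityMeasure (γk k)]
    [IsProbabilityMeasure γ] (h : WeakTendsto γk γ) {bk : ℕ → Z → ℝ} {b : Z → ℝ}
    (hbk : ∀ k, Continuous (bk k)) (hb : Continuous b) (hu : TendstoUniformly bk b atTop) :
    WeakTendsto (fun k => (γk k).map (bk k)) (γ.map b) := by
  intro f hf hbd
  let B : ℕ → C(Z, ℝ) := fun k => ⟨bk k, hbk k⟩
  let B0 : C(Z, ℝ) := ⟨b, hb⟩
  let F : C(ℝ, ℝ) := ⟨f, hf⟩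
  have hB : Tendsto B atTop (𝓝 B0) := ContinuousMap.tendsto_iff_tendstoUniformly.2 hu
  have hFB : Tendsto (fun k => F.comp (B k)) atTop (𝓝 (F.comp B0)) :=
    ((ContinuousMap.continuous_postcomp F).tendsto B0).comp hB
  rw [tendsto_iff_dist_tendsto_zero] at hFB
  have e : ∀ k, ∫ x, f x ∂((γk k).map (bk k)) = ∫ z, f (bk k z) ∂(γk k) := fun k =>
    integral_map (hbk k).measurable.aemeasurable hf.measurable.aestronglyMeasurable
  have e0 : ∫ x, f x ∂(γ.map b) = ∫ z, f (b z) ∂γ :=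
    integral_map hb.measurable.aemeasurable hf.measurable.aestronglyMeasurable
  simp only [e, e0]
  obtain ⟨C, hC⟩ := hbd
  have h1 := h (fun z => f (b z)) (hf.comp hb) ⟨C, fun z => hC _⟩
  have h2 : Tendsto (fun k => ∫ z, f (bk k z) ∂(γk k) - ∫ z, f (b z) ∂(γk k)) atTop (𝓝 0) := by
    refine squeeze_zero_norm (fun k => ?_) hFB
    have i1 : Integrable (fun z => f (bk k z)) (γk k) := cont_integrable _ (hf.comp (hbk k))
    have i2 : Integrable (fun z => f (b z)) (γk k) := cont_integrable _ (hf.comp hb)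
    rw [← integral_sub i1 i2]
    refine (norm_integral_le_of_norm_le_const (C := dist (F.comp (B k)) (F.comp B0))
      (Eventually.of_forall fun z => ?_)).trans (by simp)
    rw [← dist_eq_norm]
    exact ContinuousMap.dist_apply_le_dist (f := F.comp (B k)) (g := F.comp B0) z
  simpa using h2.add h1

lemma risk_tendsto {Z : Type*} [TopologicalSpace Z] [CompactSpace Z] [MeasurableSpace Z]
    [BorelSpace Z]
    {γk : ℕ → Measure Z} {γ : Measure Z} [∀ k, IsProbabilityMeasure (γk k)]
    [IsProbabilityMeasure γ] (h : WeakTendsto γk γ) {bk : ℕ → Z → ℝ} {b : Z → ℝ}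
    (hbk : ∀ k, Continuous (bk k)) (hb : Continuous b) (hu : TendstoUniformly bk b atTop)
    {αk : ℕ → ℝ → ℝ} {α : ℝ → ℝ} {M : ℝ}
    (hαk_mono : ∀ k, MonotoneOn (αk k) (Icc 0 1))
    (hαk_nonneg : ∀ k, ∀ m ∈ Icc (0:ℝ) 1, 0 ≤ αk k m)
    (hαk_bdd : ∀ k, ∀ m ∈ Icc (0:ℝ) 1, αk k m ≤ M)
    (hα_mono : MonotoneOn α (Icc 0 1))
    (hα_weak : WeakTendsto (fun k => lebI.map (αk k)) (lebI.map α)) :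
    Tendsto (fun k => specRisk (αk k) ((γk k).map (bk k))) atTop (𝓝 (specRisk α (γ.map b))) := by
  have : ∀ k, IsProbabilityMeasure ((γk k).map (bk k)) := fun k =>
    Measure.isProbabilityMeasure_map (hbk k).measurable.aemeasurable
  have : IsProbabilityMeasure (γ.map b) :=
    Measure.isProbabilityMeasure_map hb.measurable.aemeasurable
  obtain ⟨C, hC⟩ := isCompact_univ.exists_bound_of_continuousOn hb.continuousOn
  refine specRisk_tendsto (weak_map h hbk hb hu) (B := C + 1) ?_ hαk_mono hαk_nonneg hαk_bdd
    hα_mono hα_weak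
  filter_upwards [Metric.tendstoUniformly_iff.1 hu 1 one_pos] with k hk
  rw [ae_map_iff (hbk k).measurable.aemeasurable (measurableSet_le measurable_abs measurable_const)]
  refine Eventually.of_forall fun z => ?_
  have h1 := hk z
  have h2 := hC z (mem_univ z)
  rw [Real.dist_eq, abs_sub_comm] at h1
  rw [Real.norm_eq_abs] at h2
  have := abs_add_le (bk k z - b z) (b z)
  rw [sub_add_cancel] at this
  linarith

lemma risk_bdd {Z : Type*} [TopologicalSpace Z] [CompactSpace Z] [MeasurableSpace Z]
    [BorelSpace Z] {b : Z → ℝ} (hb : Continuous b) {α : ℝ → ℝ} {M : ℝ}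
    (h0 : ∀ m ∈ Icc (0:ℝ) 1, 0 ≤ α m) (hM : ∀ m ∈ Icc (0:ℝ) 1, α m ≤ M) :
    ∃ K, ∀ γ : Measure Z, IsProbabilityMeasure γ → specRisk α (γ.map b) ≤ K := by
  obtain ⟨C, hC⟩ := isCompact_univ.exists_bound_of_continuousOn hb.continuousOn
  refine ⟨C * M, fun γ _ => ?_⟩
  have : IsProbabilityMeasure (γ.map b) :=
    Measure.isProbabilityMeasure_map hb.measurable.aemeasurable
  refine (le_abs_self _).trans (specRisk_bound _ ?_ h0 hM)
  rw [ae_map_iff hb.measurable.aemeasurable (measurableSet_le measurable_abs measurable_const)]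
  exact Eventually.of_forall fun z => hC z (mem_univ z)

lemma marg_limit {d : ℕ} {X : Fin d → Type*} [∀ i, MeasurableSpace (X i)]
    [∀ i, TopologicalSpace (X i)] [∀ i, PolishSpace (X i)] [∀ i, BorelSpace (X i)]
    {μk : ℕ → ∀ i, Measure (X i)} {μ : ∀ i, Measure (X i)}
    [∀ i, IsProbabilityMeasure (μ i)]
    (hμ_weak : ∀ i, WeakTendsto (fun k => μk k i) (μ i))
    {γk : ℕ → Measure (∀ i, X i)} {γ : Measure (∀ i, X i)} [IsProbabilityMeasure γ]
    (hγk : ∀ k i, (γk k).map (fun z => z i) = μk k i) (h : WeakTendsto γk γ) (i : Fin d) :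
    γ.map (fun z => z i) = μ i := by
  have : IsProbabilityMeasure (γ.map (fun z => z i)) :=
    Measure.isProbabilityMeasure_map (measurable_pi_apply i).aemeasurable
  refine ext_of_forall_integral_eq_of_IsFiniteMeasure fun f => ?_
  have h1 := hμ_weak i f f.continuous ⟨‖f‖, fun x => f.norm_coe_le_norm x⟩
  have h2 := h (fun z => f (z i)) (f.continuous.comp (continuous_apply i))
    ⟨‖f‖, fun x => f.norm_coe_le_norm _⟩
  have e : ∀ ρ : Measure (∀ i, X i), ∫ x, f x ∂(ρ.map (fun z => z i)) = ∫ z, f (z i) ∂ρ := fun ρ =>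
    integral_map (measurable_pi_apply i).aemeasurable f.continuous.measurable.aestronglyMeasurable
  rw [e]
  refine tendsto_nhds_unique h2 (h1.congr fun k => ?_)
  change ∫ x, f x ∂(μk k i) = _
  rw [← hγk k i, e]

lemma WeakTendsto.comp {Z : Type*} [TopologicalSpace Z] [MeasurableSpace Z]
    {γk : ℕ → Measure Z} {γ : Measure Z} (h : WeakTendsto γk γ) {φ : ℕ → ℕ}
    (hφ : Tendsto φ atTop atTop) : WeakTendsto (fun j => γk (φ j)) γ :=
  fun f hf hb => (h f hf hb).comp hφ

end Recovery

/-- stability: under weak convergence of the marginals, uniform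
convergence of the output functions, and weak convergence of the spectral measures,
the maximal spectral risks converge, and weak limits of maximizers are maximizers. -/
theorem stmt13 (d : ℕ) (X : Fin d → Type*) [∀ i, MeasurableSpace (X i)]
    [∀ i, TopologicalSpace (X i)] [∀ i, PolishSpace (X i)] [∀ i, BorelSpace (X i)]
    [∀ i, CompactSpace (X i)]
    (μk : ℕ → ∀ i, Measure (X i)) (μ : ∀ i, Measure (X i))
    (hμk_prob : ∀ k i, IsProbabilityMeasure (μk k i))
    (hμ_prob : ∀ i, IsProbabilityMeasure (μ i))
    (hμ_weak : ∀ i, WeakTendsto (fun k => μk k i) (μ i))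
    (bk : ℕ → (∀ i, X i) → ℝ) (b : (∀ i, X i) → ℝ)
    (hbk_cont : ∀ k, Continuous (bk k)) (hb_cont : Continuous b)
    (hb_unif : TendstoUniformly bk b Filter.atTop)
    (C : ℝ) (hbC : ∀ z, b z ≤ C)
    (u : ∀ i, X i → ℝ) (hu_int : ∀ i, Integrable (u i) (μ i))
    (hb_lb : ∀ z, (∑ i, u i (z i)) ≤ b z)
    (αk : ℕ → ℝ → ℝ) (α : ℝ → ℝ) (M : ℝ)
    (hαk_mono : ∀ k, MonotoneOn (αk k) (Icc 0 1))
    (hαk_nonneg : ∀ k, ∀ m ∈ Icc (0:ℝ) 1, 0 ≤ αk k m)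
    (hαk_bdd : ∀ k, ∀ m ∈ Icc (0:ℝ) 1, αk k m ≤ M)
    (hα_mono : MonotoneOn α (Icc 0 1))
    (hα_nonneg : ∀ m ∈ Icc (0:ℝ) 1, 0 ≤ α m)
    (hα_bdd : ∀ m ∈ Icc (0:ℝ) 1, α m ≤ M)
    (hα_weak : WeakTendsto (fun k => lebI.map (αk k)) (lebI.map α)) :
    Filter.Tendsto
      (fun k => sSup {r : ℝ | ∃ γ : Measure (∀ i, X i),
        (IsProbabilityMeasure γ ∧ ∀ i, γ.map (fun z => z i) = μk k i) ∧
        r = specRisk (αk k) (γ.map (bk k))})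
      Filter.atTop
      (nhds (sSup {r : ℝ | ∃ γ : Measure (∀ i, X i),
        (IsProbabilityMeasure γ ∧ ∀ i, γ.map (fun z => z i) = μ i) ∧
        r = specRisk α (γ.map b)})) ∧
    ∀ γk : ℕ → Measure (∀ i, X i),
      (∀ k, (IsProbabilityMeasure (γk k) ∧ ∀ i, (γk k).map (fun z => z i) = μk k i) ∧
        ∀ γ' : Measure (∀ i, X i), IsProbabilityMeasure γ' →
          (∀ i, γ'.map (fun z => z i) = μk k i) →
          specRisk (αk k) (γ'.map (bk k)) ≤ specRisk (αk k) ((γk k).map (bk k))) →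
      ∀ φ : ℕ → ℕ, StrictMono φ →
      ∀ γlim : Measure (∀ i, X i), IsProbabilityMeasure γlim →
        WeakTendsto (fun j => γk (φ j)) γlim →
        (∀ i, γlim.map (fun z => z i) = μ i) ∧
        ∀ γ' : Measure (∀ i, X i), IsProbabilityMeasure γ' →
          (∀ i, γ'.map (fun z => z i) = μ i) →
          specRisk α (γ'.map b) ≤ specRisk α (γlim.map b) := by
  have hcompat : ∀ φ : ℕ → ℕ, Tendsto φ atTop atTop → ∀ γk : ℕ → Measure (∀ i, X i),
      (∀ j, IsProbabilityMeasure (γk j)) → ∀ γ : Measure (∀ i, X i), IsProbabilityMeasure γ →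
      WeakTendsto γk γ → Tendsto (fun j => specRisk (αk (φ j)) ((γk j).map (bk (φ j)))) atTop
        (𝓝 (specRisk α (γ.map b))) := by
    intro φ hφ γk _ γ _ hw
    refine risk_tendsto hw (fun j => hbk_cont (φ j)) hb_cont (fun s hs => hφ.eventually (hb_unif s hs))
      (fun j => hαk_mono (φ j)) (fun j => hαk_nonneg (φ j)) (fun j => hαk_bdd (φ j)) hα_mono
      (hα_weak.comp hφ)
  have hmarg : ∀ φ : ℕ → ℕ, Tendsto φ atTop atTop → ∀ γk : ℕ → Measure (∀ i, X i),
      (∀ j i, (γk j).map (fun z => z i) = μk (φ j) i) → ∀ γ : Measure (∀ i, X i),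
      IsProbabilityMeasure γ → WeakTendsto γk γ → ∀ i, γ.map (fun z => z i) = μ i := by
    intro φ hφ γk hγk γ _ hw i
    exact marg_limit (μk := fun j => μk (φ j)) (fun i => (hμ_weak i).comp hφ) hγk hw i
  constructor
  · set S : ℕ → Set ℝ := fun k => {r : ℝ | ∃ γ : Measure (∀ i, X i),
        (IsProbabilityMeasure γ ∧ ∀ i, γ.map (fun z => z i) = μk k i) ∧
        r = specRisk (αk k) (γ.map (bk k))} with hS
    set S0 : Set ℝ := {r : ℝ | ∃ γ : Measure (∀ i, X i),
        (IsProbabilityMeasure γ ∧ ∀ i, γ.map (fun z => z i) = μ i) ∧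
        r = specRisk α (γ.map b)} with hS0
    have hSb : ∀ k, BddAbove (S k) := by
      intro k
      obtain ⟨K, hK⟩ := risk_bdd (hbk_cont k) (hαk_nonneg k) (hαk_bdd k)
      refine ⟨K, ?_⟩
      rintro r ⟨γ, ⟨h1, -⟩, rfl⟩
      exact hK γ h1
    have hS0b : BddAbove S0 := by
      obtain ⟨K, hK⟩ := risk_bdd hb_cont hα_nonneg hα_bdd
      refine ⟨K, ?_⟩
      rintro r ⟨γ, ⟨h1, -⟩, rfl⟩
      exact hK γ h1
    have hSn : ∀ k, (S k).Nonempty := fun k =>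
      ⟨_, Measure.pi (μk k), ⟨inferInstance, fun i => (measurePreserving_eval (μk k) i).map_eq⟩, rfl⟩
    have hS0n : S0.Nonempty :=
      ⟨_, Measure.pi μ, ⟨inferInstance, fun i => (measurePreserving_eval μ i).map_eq⟩, rfl⟩
    have hlow : ∀ ε > 0, ∀ᶠ k in atTop, sSup S0 - ε < sSup (S k) := by
      intro ε hε
      obtain ⟨r, ⟨γ, ⟨hγp, hγm⟩, rfl⟩, hr⟩ := exists_lt_of_lt_csSup hS0n
        (show sSup S0 - ε < sSup S0 by linarith)
      obtain ⟨γk, h1, h2, h3⟩ := recovery hμ_weak γ hγm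
      have h4 := hcompat id tendsto_id γk h1 γ hγp h3
      filter_upwards [h4.eventually (lt_mem_nhds hr)] with k hk
      exact lt_of_lt_of_le hk (le_csSup (hSb k) ⟨γk k, ⟨h1 k, h2 k⟩, rfl⟩)
    have hch : ∀ k : ℕ, ∃ γ : Measure (∀ i, X i),
        (IsProbabilityMeasure γ ∧ ∀ i, γ.map (fun z => z i) = μk k i) ∧
        sSup (S k) - 1 / ((k:ℝ) + 1) < specRisk (αk k) (γ.map (bk k)) := by
      intro k
      obtain ⟨r, ⟨γ, h1, rfl⟩, hr⟩ := exists_lt_of_lt_csSup (hSn k)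
        (show sSup (S k) - 1 / ((k:ℝ) + 1) < sSup (S k) by
          have : (0:ℝ) < 1 / ((k:ℝ) + 1) := by positivity
          linarith)
      exact ⟨γ, h1, hr⟩
    choose γk hγk hγk_near using hch
    refine tendsto_of_subseq_tendsto fun ns hns => ?_
    let P : ℕ → ProbabilityMeasure (∀ i, X i) := fun j => ⟨γk (ns j), (hγk (ns j)).1⟩
    obtain ⟨Q, -, ψ, hψ, hlim⟩ := isCompact_univ.tendsto_subseq (x := P) fun _ => mem_univ _
    have hφ : Tendsto (fun j => ns (ψ j)) atTop atTop := hns.comp hψ.tendsto_atTop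
    have hw : WeakTendsto (fun j => γk (ns (ψ j))) (Q : Measure (∀ i, X i)) := weak_of_tendsto hlim
    have hR := hcompat _ hφ _ (fun j => (hγk (ns (ψ j))).1) _ inferInstance hw
    have hQm := hmarg _ hφ _ (fun j => (hγk (ns (ψ j))).2) _ inferInstance hw
    have hQle : specRisk α ((Q : Measure (∀ i, X i)).map b) ≤ sSup S0 :=
      le_csSup hS0b ⟨Q, ⟨inferInstance, hQm⟩, rfl⟩
    have hsmall : Tendsto (fun j => 1 / ((ns (ψ j) : ℝ) + 1)) atTop (𝓝 0) :=
      tendsto_one_div_add_atTop_nhds_zero_nat.comp hφ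
    refine ⟨ψ, ?_⟩
    have hup := hR.add hsmall
    rw [add_zero] at hup
    rw [Metric.tendsto_nhds]
    intro ε hε
    filter_upwards [hφ.eventually (hlow ε hε), hup.eventually (gt_mem_nhds
      (show specRisk α ((Q : Measure (∀ i, X i)).map b) < sSup S0 + ε by linarith))] with j h1 h2
    have h3 := hγk_near (ns (ψ j))
    rw [Real.dist_eq, abs_lt]
    constructor <;> linarith
  · intro γk hγk φ hφ γlim hγlim hw
    have hφt := hφ.tendsto_atTop
    refine ⟨hmarg φ hφt _ (fun j => (hγk (φ j)).1.2) γlim hγlim hw, fun γ' hγ' hγ'm => ?_⟩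
    obtain ⟨ρ, h1, h2, h3⟩ := recovery hμ_weak γ' hγ'm
    have h4 := hcompat φ hφt _ (fun j => h1 (φ j)) γ' hγ' (h3.comp hφt)
    have h5 := hcompat φ hφt _ (fun j => (hγk (φ j)).1.1) γlim hγlim hw
    exact le_of_tendsto_of_tendsto' h4 h5 fun j => (hγk (φ j)).2 _ (h1 _) (h2 _)
end
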